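/- For every prime p, the group G̃_p is solvable and residually finite, but not Hilbert–Schmidt stable: there exist a sequence of positive integers (n_k) and functions π_k : G̃_p → U(n_k) with lim_k ‖π_k(gh) − π_k(g)π_k(h)‖₂ = 0 for all g, h ∈ G̃_p, such that for every sequence of group homomorphisms σ_k : G̃_p → U(n_k) there is some g ∈ G̃_p with ‖π_k(g) − σ_k(g)‖₂ not converging to 0. -/

import Mathlib

def Zp (p : ℕ) : AddSubgroup ℚ where
  carrier := {q : ℚ | ∃ (k : ℤ) (n : ℕ), q * (p : ℚ) ^ n = (k : ℚ)}
  zero_mem' := ⟨0, 0, by norm_num⟩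
  add_mem' := by
    rintro a b ⟨k1, n1, h1⟩ ⟨k2, n2, h2⟩
    refine ⟨k1 * (p : ℤ) ^ n2 + k2 * (p : ℤ) ^ n1, n1 + n2, ?_⟩
    push_cast
    calc (a + b) * (p : ℚ) ^ (n1 + n2)
        = a * (p : ℚ) ^ n1 * (p : ℚ) ^ n2 + b * (p : ℚ) ^ n2 * (p : ℚ) ^ n1 := by
          rw [pow_add]; ring
      _ = (k1 : ℚ) * (p : ℚ) ^ n2 + (k2 : ℚ) * (p : ℚ) ^ n1 := by rw [h1, h2]
  neg_mem' := by
    rintro a ⟨k, n, h⟩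
    refine ⟨-k, n, ?_⟩
    push_cast
    rw [neg_mul, h]


lemma Zp.mul_mem {p : ℕ} {a b : ℚ} (ha : a ∈ Zp p) (hb : b ∈ Zp p) : a * b ∈ Zp p := by
  obtain ⟨k1, n1, h1⟩ := ha
  obtain ⟨k2, n2, h2⟩ := hb
  refine ⟨k1 * k2, n1 + n2, ?_⟩
  push_cast
  calc a * b * (p : ℚ) ^ (n1 + n2) = (a * (p : ℚ) ^ n1) * (b * (p : ℚ) ^ n2) := by
        rw [pow_add]; ring
    _ = (k1 : ℚ) * (k2 : ℚ) := by rw [h1, h2]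

lemma Zp.intCast_mem (p : ℕ) (k : ℤ) : (k : ℚ) ∈ Zp p := ⟨k, 0, by norm_num⟩

lemma Zp.zpow_mem {p : ℕ} (hp : (p : ℚ) ≠ 0) (n : ℤ) : (p : ℚ) ^ n ∈ Zp p := by
  rcases n with k | k
  · refine ⟨(p : ℤ) ^ k, 0, ?_⟩
    push_cast
    simp
  · refine ⟨1, k + 1, ?_⟩
    rw [zpow_negSucc]
    push_cast
    rw [inv_mul_cancel₀ (pow_ne_zero _ hp)]

/-- Membership predicate for the group `G̃_p`: upper triangular `5 × 5` matrices with
rows `(1, x₁₂, x₁₃, x₁₄, x₁₅)`, `(0, pⁿ, x₂₃, x₂₄, x₂₅)`, `(0, 0, pᵏ, x₃₄, x₃₅)`,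
`(0,0,0,1,m)`, `(0,0,0,0,1)` where the `xᵢⱼ ∈ ℤ[1/p]`, `k, n, m ∈ ℤ`. -/
def GtPred (p : ℕ) (M : Matrix (Fin 5) (Fin 5) ℚ) : Prop :=
  (∃ n : ℤ, M 1 1 = (p : ℚ) ^ n) ∧ (∃ k : ℤ, M 2 2 = (p : ℚ) ^ k) ∧
  (∃ m : ℤ, M 3 4 = (m : ℚ)) ∧
  M 0 0 = 1 ∧ M 3 3 = 1 ∧ M 4 4 = 1 ∧
  M 0 1 ∈ Zp p ∧ M 0 2 ∈ Zp p ∧ M 0 3 ∈ Zp p ∧ M 0 4 ∈ Zp p ∧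
  M 1 2 ∈ Zp p ∧ M 1 3 ∈ Zp p ∧ M 1 4 ∈ Zp p ∧ M 2 3 ∈ Zp p ∧ M 2 4 ∈ Zp p ∧
  M 1 0 = 0 ∧ M 2 0 = 0 ∧ M 2 1 = 0 ∧
  M 3 0 = 0 ∧ M 3 1 = 0 ∧ M 3 2 = 0 ∧
  M 4 0 = 0 ∧ M 4 1 = 0 ∧ M 4 2 = 0 ∧ M 4 3 = 0

set_option maxHeartbeats 2000000 in
/-- The group `G̃_p`, as a subgroup of the units of the `5 × 5` matrices over `ℚ`. -/
def Gt (p : ℕ) (hp : p.Prime) : Subgroup (Matrix (Fin 5) (Fin 5) ℚ)ˣ where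
  carrier := {M | GtPred p M.val}
  one_mem' := by
    refine ⟨⟨0, ?_⟩, ⟨0, ?_⟩, ⟨0, ?_⟩, ?_, ?_, ?_, ?_, ?_, ?_, ?_, ?_, ?_, ?_, ?_, ?_,
      ?_, ?_, ?_, ?_, ?_, ?_, ?_, ?_, ?_, ?_⟩ <;>
      simp [Matrix.one_apply, (Zp p).zero_mem]
  mul_mem' := by
    have hp0 : (p : ℚ) ≠ 0 := Nat.cast_ne_zero.mpr hp.ne_zero
    rintro A B ⟨⟨na, a11⟩, ⟨ka, a22⟩, ⟨ma, a34⟩, a00, a33, a44,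
      a01, a02, a03, a04, a12, a13, a14, a23, a24,
      a10, a20, a21, a30, a31, a32, a40, a41, a42, a43⟩
      ⟨⟨nb, b11⟩, ⟨kb, b22⟩, ⟨mb, b34⟩, b00, b33, b44,
      b01, b02, b03, b04, b12, b13, b14, b23, b24,
      b10, b20, b21, b30, b31, b32, b40, b41, b42, b43⟩
    have e : ∀ i j, (A.val * B.val) i j =
        A.val i 0 * B.val 0 j + A.val i 1 * B.val 1 j + A.val i 2 * B.val 2 j +
          A.val i 3 * B.val 3 j + A.val i 4 * B.val 4 j := by
      intro i j
      rw [Matrix.mul_apply, Fin.sum_univ_five]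
    refine ⟨⟨na + nb, ?_⟩, ⟨ka + kb, ?_⟩, ⟨ma + mb, ?_⟩, ?_, ?_, ?_, ?_, ?_, ?_, ?_, ?_,
      ?_, ?_, ?_, ?_, ?_, ?_, ?_, ?_, ?_, ?_, ?_, ?_, ?_, ?_⟩ <;>
      simp only [Units.val_mul, e, a11, a22, a34, a00, a33, a44,
        a10, a20, a21, a30, a31, a32, a40, a41, a42, a43,
        b11, b22, b34, b00, b33, b44,
        b10, b20, b21, b30, b31, b32, b40, b41, b42, b43,
        one_mul, mul_one, mul_zero, zero_mul, add_zero, zero_add]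
    · exact (zpow_add₀ hp0 na nb).symm
    · exact (zpow_add₀ hp0 ka kb).symm
    · push_cast; ring
    · exact (Zp p).add_mem b01 (Zp.mul_mem a01 (Zp.zpow_mem hp0 nb))
    · exact (Zp p).add_mem ((Zp p).add_mem b02 (Zp.mul_mem a01 b12))
        (Zp.mul_mem a02 (Zp.zpow_mem hp0 kb))
    · exact (Zp p).add_mem ((Zp p).add_mem ((Zp p).add_mem b03 (Zp.mul_mem a01 b13))
        (Zp.mul_mem a02 b23)) a03
    · exact (Zp p).add_mem ((Zp p).add_mem ((Zp p).add_mem ((Zp p).add_mem b04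
        (Zp.mul_mem a01 b14)) (Zp.mul_mem a02 b24))
        (Zp.mul_mem a03 (Zp.intCast_mem p mb))) a04
    · exact (Zp p).add_mem (Zp.mul_mem (Zp.zpow_mem hp0 na) b12)
        (Zp.mul_mem a12 (Zp.zpow_mem hp0 kb))
    · exact (Zp p).add_mem ((Zp p).add_mem (Zp.mul_mem (Zp.zpow_mem hp0 na) b13)
        (Zp.mul_mem a12 b23)) a13
    · exact (Zp p).add_mem ((Zp p).add_mem ((Zp p).add_mem
        (Zp.mul_mem (Zp.zpow_mem hp0 na) b14) (Zp.mul_mem a12 b24))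
        (Zp.mul_mem a13 (Zp.intCast_mem p mb))) a14
    · exact (Zp p).add_mem (Zp.mul_mem (Zp.zpow_mem hp0 ka) b23) a23
    · exact (Zp p).add_mem ((Zp p).add_mem (Zp.mul_mem (Zp.zpow_mem hp0 ka) b24)
        (Zp.mul_mem a23 (Zp.intCast_mem p mb))) a24
  inv_mem' := by
    have hp0 : (p : ℚ) ≠ 0 := Nat.cast_ne_zero.mpr hp.ne_zero
    rintro A ⟨⟨na, a11⟩, ⟨ka, a22⟩, ⟨ma, a34⟩, a00, a33, a44,
      a01, a02, a03, a04, a12, a13, a14, a23, a24,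
      a10, a20, a21, a30, a31, a32, a40, a41, a42, a43⟩
    have hu : A.val 1 1 ≠ 0 := by rw [a11]; exact zpow_ne_zero _ hp0
    have hv : A.val 2 2 ≠ 0 := by rw [a22]; exact zpow_ne_zero _ hp0
    have hiu : (A.val 1 1)⁻¹ ∈ Zp p := by
      rw [a11, ← zpow_neg]; exact Zp.zpow_mem hp0 (-na)
    have hiv : (A.val 2 2)⁻¹ ∈ Zp p := by
      rw [a22, ← zpow_neg]; exact Zp.zpow_mem hp0 (-ka)
    have hm : A.val 3 4 ∈ Zp p := by rw [a34]; exact Zp.intCast_mem p ma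
    have hinv : (A⁻¹).val =
        !![1,
           -(A.val 0 1) * (A.val 1 1)⁻¹,
           A.val 0 1 * A.val 1 2 * (A.val 1 1)⁻¹ * (A.val 2 2)⁻¹ -
             A.val 0 2 * (A.val 2 2)⁻¹,
           -(A.val 0 1) * (A.val 1 2 * A.val 2 3 * (A.val 2 2)⁻¹ - A.val 1 3) *
               (A.val 1 1)⁻¹ + A.val 0 2 * A.val 2 3 * (A.val 2 2)⁻¹ - A.val 0 3,
           A.val 0 1 * (A.val 1 2 * (A.val 2 3 * A.val 3 4 - A.val 2 4) * (A.val 2 2)⁻¹ -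
               A.val 1 3 * A.val 3 4 + A.val 1 4) * (A.val 1 1)⁻¹ -
             A.val 0 2 * (A.val 2 3 * A.val 3 4 - A.val 2 4) * (A.val 2 2)⁻¹ +
             A.val 0 3 * A.val 3 4 - A.val 0 4;
           0, (A.val 1 1)⁻¹,
           -(A.val 1 2) * (A.val 2 2)⁻¹ * (A.val 1 1)⁻¹,
           (A.val 1 2 * A.val 2 3 * (A.val 2 2)⁻¹ - A.val 1 3) * (A.val 1 1)⁻¹,
           -(A.val 1 2 * (A.val 2 3 * A.val 3 4 - A.val 2 4) * (A.val 2 2)⁻¹ -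
               A.val 1 3 * A.val 3 4 + A.val 1 4) * (A.val 1 1)⁻¹;
           0, 0, (A.val 2 2)⁻¹,
           -(A.val 2 3) * (A.val 2 2)⁻¹,
           (A.val 2 3 * A.val 3 4 - A.val 2 4) * (A.val 2 2)⁻¹;
           0, 0, 0, 1, -(A.val 3 4);
           0, 0, 0, 0, 1] := by
      apply Units.inv_eq_of_mul_eq_one_right
      ext i j
      rw [Matrix.mul_apply, Fin.sum_univ_five]
      fin_cases i <;> fin_cases j <;>
        simp [Matrix.one_apply, Matrix.vecHead, Matrix.vecTail,
          a00, a33, a44, a10, a20, a21, a30, a31, a32, a40, a41, a42, a43,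
          -mul_eq_zero] <;>
        field_simp <;>
        ring
    refine ⟨⟨-na, ?_⟩, ⟨-ka, ?_⟩, ⟨-ma, ?_⟩, ?_, ?_, ?_, ?_, ?_, ?_, ?_, ?_, ?_, ?_, ?_,
      ?_, ?_, ?_, ?_, ?_, ?_, ?_, ?_, ?_, ?_, ?_⟩ <;> rw [hinv]
    · show (A.val 1 1)⁻¹ = (p : ℚ) ^ (-na)
      rw [a11, ← zpow_neg]
    · show (A.val 2 2)⁻¹ = (p : ℚ) ^ (-ka)
      rw [a22, ← zpow_neg]
    · show -(A.val 3 4) = ((-ma : ℤ) : ℚ)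
      rw [a34]; push_cast; ring
    · show (1 : ℚ) = 1; rfl
    · show (1 : ℚ) = 1; rfl
    · show (1 : ℚ) = 1; rfl
    · show -(A.val 0 1) * (A.val 1 1)⁻¹ ∈ Zp p
      exact Zp.mul_mem ((Zp p).neg_mem a01) hiu
    · show A.val 0 1 * A.val 1 2 * (A.val 1 1)⁻¹ * (A.val 2 2)⁻¹ -
          A.val 0 2 * (A.val 2 2)⁻¹ ∈ Zp p
      exact (Zp p).sub_mem (Zp.mul_mem (Zp.mul_mem (Zp.mul_mem a01 a12) hiu) hiv)
        (Zp.mul_mem a02 hiv)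
    · show -(A.val 0 1) * (A.val 1 2 * A.val 2 3 * (A.val 2 2)⁻¹ - A.val 1 3) *
          (A.val 1 1)⁻¹ + A.val 0 2 * A.val 2 3 * (A.val 2 2)⁻¹ - A.val 0 3 ∈ Zp p
      exact (Zp p).sub_mem ((Zp p).add_mem
        (Zp.mul_mem (Zp.mul_mem ((Zp p).neg_mem a01)
          ((Zp p).sub_mem (Zp.mul_mem (Zp.mul_mem a12 a23) hiv) a13)) hiu)
        (Zp.mul_mem (Zp.mul_mem a02 a23) hiv)) a03
    · show A.val 0 1 * (A.val 1 2 * (A.val 2 3 * A.val 3 4 - A.val 2 4) * (A.val 2 2)⁻¹ -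
            A.val 1 3 * A.val 3 4 + A.val 1 4) * (A.val 1 1)⁻¹ -
          A.val 0 2 * (A.val 2 3 * A.val 3 4 - A.val 2 4) * (A.val 2 2)⁻¹ +
          A.val 0 3 * A.val 3 4 - A.val 0 4 ∈ Zp p
      refine (Zp p).sub_mem ((Zp p).add_mem ((Zp p).sub_mem ?_ ?_) ?_) a04
      · exact Zp.mul_mem (Zp.mul_mem a01 ((Zp p).add_mem ((Zp p).sub_mem
          (Zp.mul_mem (Zp.mul_mem a12 ((Zp p).sub_mem (Zp.mul_mem a23 hm) a24)) hiv)
          (Zp.mul_mem a13 hm)) a14)) hiu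
      · exact Zp.mul_mem (Zp.mul_mem a02 ((Zp p).sub_mem (Zp.mul_mem a23 hm) a24)) hiv
      · exact Zp.mul_mem a03 hm
    · show -(A.val 1 2) * (A.val 2 2)⁻¹ * (A.val 1 1)⁻¹ ∈ Zp p
      exact Zp.mul_mem (Zp.mul_mem ((Zp p).neg_mem a12) hiv) hiu
    · show (A.val 1 2 * A.val 2 3 * (A.val 2 2)⁻¹ - A.val 1 3) * (A.val 1 1)⁻¹ ∈ Zp p
      exact Zp.mul_mem ((Zp p).sub_mem (Zp.mul_mem (Zp.mul_mem a12 a23) hiv) a13) hiu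
    · show -(A.val 1 2 * (A.val 2 3 * A.val 3 4 - A.val 2 4) * (A.val 2 2)⁻¹ -
            A.val 1 3 * A.val 3 4 + A.val 1 4) * (A.val 1 1)⁻¹ ∈ Zp p
      exact Zp.mul_mem ((Zp p).neg_mem ((Zp p).add_mem ((Zp p).sub_mem
        (Zp.mul_mem (Zp.mul_mem a12 ((Zp p).sub_mem (Zp.mul_mem a23 hm) a24)) hiv)
        (Zp.mul_mem a13 hm)) a14)) hiu
    · show -(A.val 2 3) * (A.val 2 2)⁻¹ ∈ Zp p
      exact Zp.mul_mem ((Zp p).neg_mem a23) hiv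
    · show (A.val 2 3 * A.val 3 4 - A.val 2 4) * (A.val 2 2)⁻¹ ∈ Zp p
      exact Zp.mul_mem ((Zp p).sub_mem (Zp.mul_mem a23 hm) a24) hiv
    · show (0 : ℚ) = 0; rfl
    · show (0 : ℚ) = 0; rfl
    · show (0 : ℚ) = 0; rfl
    · show (0 : ℚ) = 0; rfl
    · show (0 : ℚ) = 0; rfl
    · show (0 : ℚ) = 0; rfl
    · show (0 : ℚ) = 0; rfl
    · show (0 : ℚ) = 0; rfl
    · show (0 : ℚ) = 0; rfl
    · show (0 : ℚ) = 0; rfl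

/-- The normalized Hilbert–Schmidt norm `‖A‖₂ = (Tr_n(A*A))^{1/2}` of an `n × n`
complex matrix, where `Tr_n` is the normalized trace. -/
noncomputable def hsNorm (n : ℕ) (A : Matrix (Fin n) (Fin n) ℂ) : ℝ :=
  Real.sqrt ((A.conjTranspose * A).trace.re / n)


/-- The matrices whose entries vanish below the `d`-th superdiagonal. -/
def upperBand (R : Type*) [Ring R] (m d : ℕ) : AddSubgroup (Matrix (Fin m) (Fin m) R) where
  carrier := {A | ∀ i j : Fin m, (j : ℕ) < i + d → A i j = 0}
  zero_mem' := fun _ _ _ => rfl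
  add_mem' := fun hA hB i j h => by simp [hA i j h, hB i j h]
  neg_mem' := fun hA i j h => by simp [hA i j h]

lemma upperBand_mul_mem {R : Type*} [Ring R] {m d e : ℕ} {A B : Matrix (Fin m) (Fin m) R}
    (hA : A ∈ upperBand R m d) (hB : B ∈ upperBand R m e) : A * B ∈ upperBand R m (d + e) := by
  intro i j hij
  rw [Matrix.mul_apply]
  refine Finset.sum_eq_zero fun k _ => ?_
  rcases lt_or_ge (k : ℕ) (i + d) with h | h
  · rw [hA i k h, zero_mul]
  · rw [hB k j (by omega), mul_zero]

lemma upperBand_anti {R : Type*} [Ring R] {m d e : ℕ} (h : d ≤ e) :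
    upperBand R m e ≤ upperBand R m d :=
  fun _ hA i j hij => hA i j (by omega)

lemma commute_mod_upperBand_one {R : Type*} [CommRing R] {m : ℕ} {A B : Matrix (Fin m) (Fin m) R}
    (hA : A ∈ upperBand R m 0) (hB : B ∈ upperBand R m 0) :
    A * B - B * A ∈ upperBand R m 1 := by
  have key : ∀ {A B : Matrix (Fin m) (Fin m) R}, A ∈ upperBand R m 0 → B ∈ upperBand R m 0 →
      ∀ i, (A * B) i i = A i i * B i i := by
    intro A B hA hB i
    rw [Matrix.mul_apply, Finset.sum_eq_single i _ (by simp)]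
    intro k _ hk
    rcases lt_or_gt_of_ne hk with h | h
    · rw [hA i k (by simpa using h), zero_mul]
    · rw [hB k i (by simpa using h), mul_zero]
  intro i j hij
  rcases (Nat.lt_succ_iff.mp hij).lt_or_eq with h | h
  · exact (upperBand R m 0).sub_mem (upperBand_mul_mem hA hB) (upperBand_mul_mem hB hA) i j h
  · obtain rfl : j = i := Fin.ext h
    rw [Matrix.sub_apply, key hA hB, key hB hA, mul_comm, sub_self]

/-- The units congruent to `1` modulo the `d`-th superdiagonal, in a group of invertible upper
triangular matrices. -/
def bandSubgroup {R : Type*} [CommRing R] {m : ℕ} (G : Subgroup (Matrix (Fin m) (Fin m) R)ˣ)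
    (hG : ∀ g ∈ G, g.val ∈ upperBand R m 0) (d : ℕ) : Subgroup G where
  carrier := {g | g.val.val - 1 ∈ upperBand R m d}
  one_mem' := by simp
  mul_mem' := by
    intro g h hg hh
    have e : (g * h).val.val - 1 = g.val.val * (h.val.val - 1) + (g.val.val - 1) := by
      simp [mul_sub]
    rw [Set.mem_ofPred_eq, e]
    exact add_mem (by simpa using upperBand_mul_mem (hG _ g.2) hh) hg
  inv_mem' := by
    intro g hg
    have e : (g⁻¹).val.val - 1 = -((g⁻¹).val.val * (g.val.val - 1)) := by
      simp [mul_sub]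
    rw [Set.mem_ofPred_eq, e]
    exact neg_mem (by simpa using upperBand_mul_mem (hG _ (g⁻¹).2) hg)

open scoped commutatorElement in
lemma isSolvable_of_upperTriangular {R : Type*} [CommRing R] {m : ℕ}
    (G : Subgroup (Matrix (Fin m) (Fin m) R)ˣ) (hG : ∀ g ∈ G, g.val ∈ upperBand R m 0) :
    Group.IsSolvable G := by
  have key : ∀ d, derivedSeries G d ≤ bandSubgroup G hG d := by
    intro d
    induction d with
    | zero =>
      intro g _
      exact sub_mem (hG _ g.2) (hG 1 G.one_mem)
    | succ d ih =>
      rw [derivedSeries_succ]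
      refine (Subgroup.commutator_mono ih ih).trans (Subgroup.commutator_le.mpr ?_)
      intro g hg h hh
      have e : (⁅g, h⁆ : G).val.val - 1 =
          (g.val.val * h.val.val - h.val.val * g.val.val) * ((h * g)⁻¹ : G).val.val := by
        rw [sub_mul]
        congr 1
        · rw [commutatorElement_def]
          simp [mul_assoc]
        · rw [← Units.val_mul, ← Subgroup.coe_mul, ← Units.val_mul, ← Subgroup.coe_mul]
          simp
      change _ ∈ upperBand R m (d + 1)
      rw [e, ← add_zero (d + 1)]
      refine upperBand_mul_mem ?_ (hG _ (Subtype.prop _))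
      rcases Nat.eq_zero_or_pos d with rfl | hd
      · exact commute_mod_upperBand_one (hG _ g.2) (hG _ h.2)
      · have e2 : g.val.val * h.val.val - h.val.val * g.val.val =
            (g.val.val - 1) * (h.val.val - 1) - (h.val.val - 1) * (g.val.val - 1) := by
          noncomm_ring
        rw [e2]
        exact upperBand_anti (by omega) (sub_mem (upperBand_mul_mem hg hh) (upperBand_mul_mem hh hg))
  refine ⟨⟨m, (Subgroup.eq_bot_iff_forall _).mpr fun g hg => ?_⟩⟩
  ext i j
  have := key m hg i j (by have := j.2; omega)
  simpa [sub_eq_zero] using this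

lemma Gt_upper {p : ℕ} {hp : p.Prime} (g : (Matrix (Fin 5) (Fin 5) ℚ)ˣ) (hg : g ∈ Gt p hp) :
    g.val ∈ upperBand ℚ 5 0 := by
  obtain ⟨-, -, -, -, -, -, -, -, -, -, -, -, -, -, -, h⟩ := hg
  intro i j hij
  fin_cases i <;> fin_cases j <;> first | simp at hij; done | simp [h]

lemma Gt_entry_mem {p : ℕ} {hp : p.Prime} (g : Gt p hp) (i j : Fin 5) :
    g.val.val i j ∈ Zp p := by
  have hp0 : (p : ℚ) ≠ 0 := Nat.cast_ne_zero.mpr hp.ne_zero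
  obtain ⟨⟨n, h1⟩, ⟨k, h2⟩, ⟨m, h3⟩, h⟩ := g.2
  have := Zp.zpow_mem hp0 n
  have := Zp.zpow_mem hp0 k
  have := Zp.intCast_mem p m
  have := Zp.intCast_mem p 1
  have := (Zp p).zero_mem
  fin_cases i <;> fin_cases j <;> simp_all

/-- `Zp p` as a subring of `ℚ`. -/
def ZpRing (p : ℕ) : Subring ℚ :=
  { Zp p with
    mul_mem' := Zp.mul_mem
    one_mem' := by simpa using Zp.intCast_mem p 1 }

lemma Zp.den_cast_ne_zero {p q : ℕ} (hq : q.Prime) (hqp : ¬ q ∣ p) {x : ℚ} (hx : x ∈ Zp p) :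
    (x.den : ZMod q) ≠ 0 := by
  obtain ⟨k, n, h⟩ := hx
  rw [Ne, ZMod.natCast_eq_zero_iff]
  intro hd
  have hdvd : (x.den : ℤ) ∣ (p : ℤ) ^ n := by
    have h' : x.num * (p : ℤ) ^ n = k * x.den := by
      have hd0 : (x.den : ℚ) ≠ 0 := by exact_mod_cast x.den_nz
      rw [← Rat.num_div_den x, div_mul_eq_mul_div, div_eq_iff hd0] at h
      exact_mod_cast h
    exact (Int.isCoprime_iff_gcd_eq_one.mpr (by
      simpa [Int.gcd] using x.reduced.symm)).dvd_of_dvd_mul_left ⟨k, by rw [h']; ring⟩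
  exact hqp (hq.dvd_of_dvd_pow (hd.trans (by exact_mod_cast hdvd)))

/-- Reduction of `ℤ[1/p]` modulo a prime `q` not dividing `p`. -/
def ZpRing.toZMod (p q : ℕ) [Fact q.Prime] (hqp : ¬ q ∣ p) : ZpRing p →+* ZMod q where
  toFun x := ((x : ℚ) : ZMod q)
  map_one' := by simp
  map_zero' := by simp
  map_mul' x y := by
    simpa using Rat.cast_mul_of_ne_zero (Zp.den_cast_ne_zero Fact.out hqp x.2)
      (Zp.den_cast_ne_zero Fact.out hqp y.2)
  map_add' x y := by
    simpa using Rat.cast_add_of_ne_zero (Zp.den_cast_ne_zero Fact.out hqp x.2)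
      (Zp.den_cast_ne_zero Fact.out hqp y.2)

/-- The inclusion of `G̃_p` in the matrices over `ℤ[1/p]`. -/
def Gt.toMatrix (p : ℕ) (hp : p.Prime) : Gt p hp →* Matrix (Fin 5) (Fin 5) (ZpRing p) where
  toFun g := Matrix.of fun i j => ⟨g.val.val i j, Gt_entry_mem g i j⟩
  map_one' := by
    ext i j
    by_cases h : i = j
    · subst h
      simp
    · simp [h]
  map_mul' g h := by
    ext i j
    simp [Matrix.mul_apply]

lemma exists_prime_cast_ne_zero (p : ℕ) (hp : p.Prime) {x : ℚ} (hx : x ≠ 0) :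
    ∃ q : ℕ, q.Prime ∧ ¬ q ∣ p ∧ ¬ (q : ℤ) ∣ x.num := by
  obtain ⟨q, hq, hqp⟩ := Nat.exists_infinite_primes (p + x.num.natAbs + 1)
  refine ⟨q, hqp, fun h => ?_, fun h => ?_⟩
  · have := Nat.le_of_dvd hp.pos h
    omega
  · have := Nat.le_of_dvd (Int.natAbs_pos.mpr (Rat.num_ne_zero.mpr hx)) (Int.natCast_dvd.mp h)
    omega

lemma Gt_residuallyFinite (p : ℕ) (hp : p.Prime) (g : Gt p hp) (hg : g ≠ 1) :
    ∃ (Q : Type) (_ : Fintype Q) (_ : Group Q) (φ : Gt p hp →* Q), φ g ≠ 1 := by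
  obtain ⟨i, j, hij⟩ : ∃ i j, (Gt.toMatrix p hp g - 1) i j ≠ 0 := by
    by_contra! h
    apply hg
    ext i j
    have := congrArg Subtype.val (h i j)
    by_cases e : i = j <;> simpa [Gt.toMatrix, e, sub_eq_zero] using this
  obtain ⟨q, hq, hqp, hqx⟩ := exists_prime_cast_ne_zero p hp
    (x := ((Gt.toMatrix p hp g - 1) i j : ZpRing p)) (fun h => hij (Subtype.ext h))
  have : Fact q.Prime := ⟨hq⟩
  let f := (ZpRing.toZMod p q hqp).mapMatrix (m := Fin 5)
  refine ⟨(Matrix (Fin 5) (Fin 5) (ZMod q))ˣ, inferInstance, inferInstance,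
    (f.toMonoidHom.comp (Gt.toMatrix p hp)).toHomUnits, fun h => ?_⟩
  have h1 : f (Gt.toMatrix p hp g - 1) = 0 := by
    rw [map_sub, map_one, sub_eq_zero]
    exact congrArg Units.val h
  have h2 := congrFun (congrFun h1 i) j
  have h3 : (((Gt.toMatrix p hp g - 1) i j : ℚ) : ZMod q) = 0 := h2
  rw [Rat.cast_def, div_eq_zero_iff, or_iff_left
    (Zp.den_cast_ne_zero hq hqp ((Gt.toMatrix p hp g - 1) i j).2),
    ZMod.intCast_zmod_eq_zero_iff_dvd] at h3
  exact hqx h3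

lemma hsNorm_eq_frobenius (n : ℕ) (A : Matrix (Fin n) (Fin n) ℂ) :
    hsNorm n A = ‖WithLp.toLp 2 fun ij : Fin n × Fin n => A ij.1 ij.2‖ / √n := by
  rw [EuclideanSpace.norm_eq, ← Real.sqrt_div' _ (Nat.cast_nonneg n), hsNorm, Matrix.trace]
  congr 2
  simp only [Matrix.diag_apply, Matrix.mul_apply, Matrix.conjTranspose_apply, Complex.re_sum,
    Fintype.sum_prod_type_right]
  refine Finset.sum_congr rfl fun i _ => Finset.sum_congr rfl fun j _ => ?_
  rw [← Complex.normSq_eq_norm_sq, Complex.star_def, ← Complex.normSq_eq_conj_mul_self,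
    Complex.ofReal_re]

lemma hsNorm_add_le (n : ℕ) (A B : Matrix (Fin n) (Fin n) ℂ) :
    hsNorm n (A + B) ≤ hsNorm n A + hsNorm n B := by
  simp only [hsNorm_eq_frobenius, ← add_div]
  gcongr
  exact norm_add_le (WithLp.toLp 2 fun ij : Fin n × Fin n => A ij.1 ij.2)
    (WithLp.toLp 2 fun ij : Fin n × Fin n => B ij.1 ij.2)

lemma hsNorm_sub_comm (n : ℕ) (A B : Matrix (Fin n) (Fin n) ℂ) :
    hsNorm n (A - B) = hsNorm n (B - A) := by
  rw [hsNorm, hsNorm, ← neg_sub B A, Matrix.conjTranspose_neg, neg_mul_neg]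

lemma hsNorm_sub_le (n : ℕ) (A B C : Matrix (Fin n) (Fin n) ℂ) :
    hsNorm n (A - C) ≤ hsNorm n (A - B) + hsNorm n (B - C) := by
  simpa using hsNorm_add_le n (A - B) (B - C)

lemma hsNorm_nonneg (n : ℕ) (A : Matrix (Fin n) (Fin n) ℂ) : 0 ≤ hsNorm n A :=
  Real.sqrt_nonneg _

lemma hsNorm_unitary_mul (n : ℕ) (U : Matrix.unitaryGroup (Fin n) ℂ)
    (A : Matrix (Fin n) (Fin n) ℂ) : hsNorm n ((U : Matrix (Fin n) (Fin n) ℂ) * A) = hsNorm n A := by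
  have h := Matrix.mem_unitaryGroup_iff'.mp U.2
  rw [Matrix.star_eq_conjTranspose] at h
  rw [hsNorm, hsNorm, Matrix.conjTranspose_mul, Matrix.mul_assoc, ← Matrix.mul_assoc _ U.val,
    h, Matrix.one_mul]

lemma hsNorm_unitary_sub_one_congr {n : ℕ} {U V : Matrix.unitaryGroup (Fin n) ℂ}
    (h : U.val.trace = V.val.trace) : hsNorm n (U.val - 1) = hsNorm n (V.val - 1) := by
  have key : ∀ U : Matrix.unitaryGroup (Fin n) ℂ,
      ((U.val - 1).conjTranspose * (U.val - 1)).trace = 2 * n - U.val.trace - star U.val.trace := by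
    intro U
    have h := Matrix.mem_unitaryGroup_iff'.mp U.2
    rw [Matrix.star_eq_conjTranspose] at h
    rw [Matrix.conjTranspose_sub, Matrix.sub_mul, Matrix.mul_sub, Matrix.mul_sub, h]
    simp [Matrix.trace_conjTranspose]
    ring
  rw [hsNorm, hsNorm, key, key, h]

/-- If a unitary `T` commutes with `Z` and conjugates `U` to `U * Z`, then
`tr (U * Z ^ j) = tr U`. -/
lemma trace_mul_pow_eq {n : ℕ} {U Z T : Matrix.unitaryGroup (Fin n) ℂ}
    (hTZ : Commute T Z) (hT : T⁻¹ * U * T = U * Z) (j : ℕ) :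
    (U * Z ^ j).val.trace = U.val.trace := by
  induction j with
  | zero => simp
  | succ j ih =>
    have : U * Z ^ (j + 1) = T⁻¹ * ((U * Z ^ j) * T) := by
      rw [pow_succ', ← mul_assoc, ← hT, mul_assoc _ T, (hTZ.pow_right j).eq]
      simp only [mul_assoc]
    rw [this, Submonoid.coe_mul, Matrix.trace_mul_comm, ← Submonoid.coe_mul, mul_inv_cancel_right,
      ih]

lemma hsNorm_pow_sub_one_le {n : ℕ} {U Z T : Matrix.unitaryGroup (Fin n) ℂ}
    (hTZ : Commute T Z) (hT : T⁻¹ * U * T = U * Z) (j : ℕ) :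
    hsNorm n ((Z ^ j).val - 1) ≤ 2 * hsNorm n (U.val - 1) := by
  have h1 : hsNorm n ((Z ^ j).val - 1) = hsNorm n ((U * Z ^ j).val - U.val) := by
    rw [← hsNorm_unitary_mul n U, Submonoid.coe_mul, Matrix.mul_sub, Matrix.mul_one]
  have h2 := hsNorm_sub_le n (U * Z ^ j).val 1 U.val
  rw [hsNorm_unitary_sub_one_congr (trace_mul_pow_eq hTZ hT j), hsNorm_sub_comm n 1] at h2
  linarith

lemma eigenvalue_pow_factorial_eq_one {n : ℕ} {A B W : Module.End ℂ (Fin n → ℂ)}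
    (hA : IsUnit A) (hB : IsUnit B) (hWA : Commute W A) (hWB : Commute W B)
    (h : A * B = W * (B * A)) {μ : ℂ} (hμ : W.HasEigenvalue μ) : μ ^ n.factorial = 1 := by
  set E := W.eigenspace μ with hE
  have hmA : ∀ x ∈ E, A x ∈ E := Module.End.mapsTo_genEigenspace_of_comm hWA μ 1
  have hmB : ∀ x ∈ E, B x ∈ E := Module.End.mapsTo_genEigenspace_of_comm hWB μ 1
  have hdet : ∀ {C : Module.End ℂ (Fin n → ℂ)} (_ : IsUnit C) (hC : ∀ x ∈ E, C x ∈ E),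
      (C.restrict hC).det ≠ 0 := by
    intro C hC hm
    rw [← isUnit_iff_ne_zero, ← LinearMap.isUnit_iff_isUnit_det, LinearMap.isUnit_iff_ker_eq_bot,
      LinearMap.ker_eq_bot]
    intro x y hxy
    have hinj : Function.Injective C :=
      LinearMap.ker_eq_bot.mp ((LinearMap.isUnit_iff_ker_eq_bot C).mp hC)
    exact Subtype.ext (hinj (congrArg Subtype.val hxy))
  have hmul : A.restrict hmA * B.restrict hmB = μ • (B.restrict hmB * A.restrict hmA) := by
    ext x : 2
    have := LinearMap.congr_fun h x
    simp only [Module.End.mul_apply] at this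
    simp only [Module.End.mul_apply, LinearMap.smul_apply, LinearMap.coe_restrict_apply,
      Submodule.coe_smul, this]
    exact Module.End.mem_eigenspace_iff.mp (hmB _ (hmA _ x.2))
  have hd := congrArg LinearMap.det hmul
  rw [LinearMap.det_smul, map_mul, map_mul, mul_comm (LinearMap.det (B.restrict hmB))] at hd
  have hpow : μ ^ Module.finrank ℂ E = 1 :=
    (mul_eq_right₀ (mul_ne_zero (hdet hA hmA) (hdet hB hmB))).mp hd.symm
  have hpos : 0 < Module.finrank ℂ E :=
    Module.finrank_pos_iff.mpr (Submodule.nontrivial_iff_ne_bot.mpr hμ)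
  have hle : Module.finrank ℂ E ≤ n := by simpa using Submodule.finrank_le E
  obtain ⟨c, hc⟩ := Nat.dvd_factorial hpos hle
  rw [hc, pow_mul, hpow, one_pow]

open scoped Matrix.Norms.L2Operator in
lemma unitary_pow_eq_one_of_eigenvalues {n N : ℕ} (hN : 0 < N) (W : Matrix.unitaryGroup (Fin n) ℂ)
    (h : ∀ μ ∈ spectrum ℂ W.val, μ ^ N = 1) : W ^ N = 1 := by
  apply Subtype.ext
  have hn : IsStarNormal ((W ^ N : Matrix.unitaryGroup (Fin n) ℂ) : Matrix (Fin n) (Fin n) ℂ) :=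
    ⟨(Matrix.mem_unitaryGroup_iff'.mp (W ^ N).2).trans
      (Matrix.mem_unitaryGroup_iff.mp (W ^ N).2).symm⟩
  refine CFC.eq_one_of_spectrum_subset_one (R := ℂ) _ ?_ hn
  rw [SubmonoidClass.coe_pow, spectrum.map_pow_of_pos _ hN]
  rintro _ ⟨μ, hμ, rfl⟩
  exact h μ hμ

lemma unitary_central_commutator_pow_factorial {n : ℕ} {A B W : Matrix.unitaryGroup (Fin n) ℂ}
    (hWA : Commute W A) (hWB : Commute W B) (h : A * B = W * (B * A)) : W ^ n.factorial = 1 := by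
  let f : Matrix.unitaryGroup (Fin n) ℂ →* Module.End ℂ (Fin n → ℂ) :=
    (Matrix.toLinAlgEquiv' (R := ℂ) (n := Fin n)).toAlgHom.toMonoidHom.comp (Submonoid.subtype _)
  refine unitary_pow_eq_one_of_eigenvalues n.factorial_pos W fun μ hμ => ?_
  refine eigenvalue_pow_factorial_eq_one (A := f A) (B := f B) (W := f W)
    ((Group.isUnit A).map f) ((Group.isUnit B).map f) (hWA.map f) (hWB.map f)
    (by simpa only [map_mul] using congrArg f h) ?_
  rw [Module.End.hasEigenvalue_iff_mem_spectrum, ← Matrix.spectrum_toLin'] at *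
  exact hμ

lemma hsNorm_permMatrix_sub {n : ℕ} (σ τ : Equiv.Perm (Fin n)) :
    hsNorm n (σ.permMatrix ℂ - τ.permMatrix ℂ) =
      √(2 * ({i | σ i ≠ τ i} : Finset (Fin n)).card / n) := by
  have key : ∀ σ τ : Equiv.Perm (Fin n), (σ.permMatrix ℂ * (τ⁻¹).permMatrix ℂ).trace =
      (({i | σ i = τ i} : Finset (Fin n)).card : ℂ) := by
    intro σ τ
    rw [← Matrix.permMatrix_mul, Matrix.trace_permutation, ← Set.ncard_coe_finset]
    congr 3
    ext i
    simp [Function.IsFixedPt, Equiv.symm_apply_eq]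
  have hc := Finset.card_filter_add_card_filter_not (s := (Finset.univ : Finset (Fin n)))
    (fun i => σ i = τ i)
  have hc' : (({i | σ i = τ i} : Finset (Fin n)).card : ℝ) +
      ({i | σ i ≠ τ i} : Finset (Fin n)).card = n := by
    exact_mod_cast hc.trans (by simp)
  rw [hsNorm, Matrix.trace_mul_comm, Matrix.conjTranspose_sub, Matrix.conjTranspose_permMatrix,
    Matrix.conjTranspose_permMatrix, Matrix.sub_mul, Matrix.mul_sub, Matrix.mul_sub]
  simp only [Matrix.trace_sub, key, Complex.sub_re, Complex.natCast_re]
  simp only [eq_comm (a := τ _), Finset.filter_true, Finset.card_univ, Fintype.card_fin]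
  congr 2
  linarith

lemma exists_perm_extending {X : Type*} (F : Finset X) (f : Equiv.Perm X) :
    ∃ τ : Equiv.Perm F, ∀ x : F, f x ∈ F → (τ x : X) = f x := by
  classical
  let e : {x : F // f x ∈ F} ≃ {y : F // f.symm y ∈ F} :=
    { toFun := fun x => ⟨⟨f x, x.2⟩, by simp⟩
      invFun := fun y => ⟨⟨f.symm y, y.2⟩, by simp⟩
      left_inv := fun x => by simp
      right_inv := fun y => by simp }
  exact ⟨e.extendSubtype, fun x hx => by rw [e.extendSubtype_apply_of_mem x hx]; rfl⟩

open Classical in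
/-- The proportion of points of `F` which are moved out of `F` by `f`. -/
noncomputable def escapeRatio {X : Type*} (F : Finset X) (f : X → X) : ℝ :=
  ((F.filter fun x => f x ∉ F).card : ℝ) / F.card

lemma permMatrix_mem_unitaryGroup {n : ℕ} (σ : Equiv.Perm (Fin n)) :
    σ.permMatrix ℂ ∈ Matrix.unitaryGroup (Fin n) ℂ := by
  rw [Matrix.mem_unitaryGroup_iff, Matrix.star_eq_conjTranspose, Matrix.conjTranspose_permMatrix,
    ← Matrix.permMatrix_mul, inv_mul_cancel, Matrix.permMatrix_one]

lemma exists_almost_hom {G X : Type*} [Group G] (ρ : G → Equiv.Perm X)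
    (hρ : ∀ g h x, ρ (g * h) x = ρ h (ρ g x)) (F : Finset X) (hF : F.Nonempty) :
    ∃ π : G → Matrix.unitaryGroup (Fin F.card) ℂ,
      (∀ g h, hsNorm F.card ((π (g * h)).val - (π g).val * (π h).val) ≤
        √(2 * (escapeRatio F (ρ g) + escapeRatio F (ρ (g * h))))) ∧
      (∀ g, (∀ x, ρ g x = x) → π g = 1) ∧
      ∀ g, (∀ x, ρ g x ≠ x) →
        √(2 * (1 - escapeRatio F (ρ g))) ≤ hsNorm F.card ((π g).val - 1) := by
  classical
  choose τ hτ using fun g => exists_perm_extending F (ρ g)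
  have hpos : (0 : ℝ) < F.card := by exact_mod_cast hF.card_pos
  let e := F.equivFin
  let s : G → Equiv.Perm (Fin F.card) := fun g => e.permCongr (τ g)
  have hs : ∀ g x, s g (e x) = e (τ g x) := fun g x => by simp [s]
  have hbad : ∀ g, ((Finset.univ.filter fun i => ρ g (e.symm i) ∉ F).card : ℝ) / F.card =
      escapeRatio F (ρ g) := by
    intro g
    rw [escapeRatio]
    congr 2
    refine Finset.card_bij (fun i _ => (e.symm i : X)) (fun i hi => ?_) (fun i _ j _ h => ?_)
      (fun x hx => ?_)
    · simpa using hi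
    · exact e.symm.injective (Subtype.ext h)
    · rw [Finset.mem_filter] at hx
      exact ⟨e ⟨x, hx.1⟩, by simpa using hx.2, by simp⟩
  refine ⟨fun g => ⟨(s g).permMatrix ℂ, permMatrix_mem_unitaryGroup _⟩, fun g h => ?_,
    fun g hg => ?_, fun g hg => ?_⟩
  · change hsNorm F.card ((s (g * h)).permMatrix ℂ - (s g).permMatrix ℂ * (s h).permMatrix ℂ) ≤ _
    rw [← Matrix.permMatrix_mul, hsNorm_permMatrix_sub]
    refine Real.sqrt_le_sqrt ?_
    rw [mul_div_assoc, ← hbad, ← hbad, ← add_div]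
    gcongr
    norm_cast
    refine le_trans (Finset.card_le_card ?_) (Finset.card_union_le _ _)
    intro i hi
    rw [Finset.mem_filter] at hi
    by_contra hcon
    simp only [Finset.mem_union, Finset.mem_filter, Finset.mem_univ, true_and, not_or,
      not_not] at hcon
    refine hi.2 ?_
    obtain ⟨x, rfl⟩ := e.surjective i
    rw [Equiv.symm_apply_apply] at hcon
    have h1 := hτ g x hcon.1
    have h2 := hτ (g * h) x hcon.2
    have h3 := hτ h (τ g x) (by rw [h1, ← hρ]; exact hcon.2)
    rw [Equiv.Perm.mul_apply, hs, hs, hs]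
    congr 1
    exact Subtype.ext (by rw [h2, h3, h1, hρ])
  · have : s g = 1 := by
      ext1 i
      obtain ⟨x, rfl⟩ := e.surjective i
      rw [hs, Equiv.Perm.one_apply]
      congr 1
      exact Subtype.ext (by rw [hτ g x (by rw [hg]; exact x.2), hg])
    exact Subtype.ext (by simp [this])
  · change _ ≤ hsNorm F.card ((s g).permMatrix ℂ - 1)
    rw [← Matrix.permMatrix_one, hsNorm_permMatrix_sub]
    refine Real.sqrt_le_sqrt ?_
    rw [mul_div_assoc, ← hbad, one_sub_div hpos.ne']
    gcongr
    rw [sub_le_iff_le_add, ← Nat.cast_add, Nat.cast_le]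
    calc F.card = (Finset.univ : Finset (Fin F.card)).card := by simp
      _ ≤ _ := le_trans (Finset.card_le_card ?_) (Finset.card_union_le _ _)
    intro i _
    rw [Finset.mem_union, Finset.mem_filter, Finset.mem_filter]
    by_contra! hcon
    obtain ⟨x, rfl⟩ := e.surjective i
    have h1 := hcon.1 (Finset.mem_univ _)
    have h2 := hcon.2 (Finset.mem_univ _)
    rw [hs, Equiv.Perm.one_apply] at h1
    rw [Equiv.symm_apply_apply] at h2
    exact hg x ((hτ g x h2).symm.trans (congrArg Subtype.val (e.injective h1)))

lemma escapeRatio_nonneg {X : Type*} (F : Finset X) (f : X → X) : 0 ≤ escapeRatio F f := by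
  unfold escapeRatio
  positivity

lemma escapeRatio_eq {X : Type*} (F : Finset X) (f : X → X) [DecidablePred fun x => f x ∉ F] :
    escapeRatio F f = ((F.filter fun x => f x ∉ F).card : ℝ) / F.card := by
  rw [escapeRatio]
  congr!

lemma escapeRatio_le_iff {X : Type*} {F : Finset X} (hF : F.Nonempty) {f : X → X} {ε : ℝ}
    [DecidablePred fun x => f x ∉ F] :
    escapeRatio F f ≤ ε ↔ ((F.filter fun x => f x ∉ F).card : ℝ) ≤ ε * F.card := by
  have hpos : (0 : ℝ) < F.card := by exact_mod_cast hF.card_pos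
  rw [escapeRatio_eq, div_le_iff₀ hpos]

/-- Escape ratio of a skew product map. -/
lemma escapeRatio_skewProduct_le {X Y : Type*} {F : Finset X} {E : Finset Y} (hF : F.Nonempty)
    (hE : E.Nonempty) {f : X → X} {h : X → Y → Y} {δ ε : ℝ} (hf : escapeRatio F f ≤ δ) (hε : 0 ≤ ε)
    (hh : ∀ x ∈ F, f x ∈ F → escapeRatio E (h x) ≤ ε) :
    escapeRatio (F ×ˢ E) (fun z => (f z.1, h z.1 z.2)) ≤ δ + ε := by
  classical
  rw [escapeRatio_le_iff (hF.product hE), Finset.card_product, Nat.cast_mul]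
  rw [escapeRatio_le_iff hF] at hf
  rw [Finset.card_filter, Finset.sum_product, Nat.cast_sum]
  calc ∑ x ∈ F, ((∑ y ∈ E, if (f x, h x y) ∉ F ×ˢ E then 1 else 0 : ℕ) : ℝ)
      ≤ ∑ x ∈ F, ((if f x ∉ F then 1 else 0) + ε) * (E.card : ℝ) := by
        refine Finset.sum_le_sum fun x hx => ?_
        rw [← Finset.card_filter]
        by_cases hfx : f x ∈ F
        · have := (escapeRatio_le_iff hE).mp (hh x hx hfx)
          simpa [hfx] using this
        · have : 0 ≤ ε * E.card := by positivity
          simpa [hfx, add_mul] using this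
    _ = ((F.filter fun x => f x ∉ F).card + ε * F.card) * E.card := by
        rw [← Finset.sum_mul, Finset.sum_add_distrib, Finset.card_filter]
        simp [mul_comm]
    _ ≤ (δ * F.card + ε * F.card) * E.card := by gcongr
    _ = _ := by ring

lemma escapeRatio_eq_zero {X : Type*} {F : Finset X} {f : X → X} (h : ∀ x ∈ F, f x ∈ F) :
    escapeRatio F f = 0 := by
  classical
  rw [escapeRatio, Finset.filter_false_of_mem (by simpa using h)]
  simp

lemma escapeRatio_image {X Y : Type*} [DecidableEq Y] {e : X → Y} (he : Function.Injective e)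
    {f : X → X} {f' : Y → Y} (hf : ∀ x, f' (e x) = e (f x)) (F : Finset X) :
    escapeRatio (F.image e) f' = escapeRatio F f := by
  classical
  rw [escapeRatio_eq, escapeRatio_eq, Finset.filter_image, Finset.card_image_of_injective _ he,
    Finset.card_image_of_injective _ he]
  simp only [hf, he.mem_finset_image]

lemma escapeRatio_Ico_le (M : ℕ) (hM : 0 < M) (s : ℤ) :
    escapeRatio (Finset.Ico (0 : ℤ) M) (fun x => x + s) ≤ |(s : ℝ)| / M := by
  classical
  have hM' : (M : ℝ) ≠ 0 := by positivity
  rw [escapeRatio_le_iff (Finset.nonempty_Ico.mpr (by omega)), Int.card_Ico, sub_zero,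
    Int.toNat_natCast, div_mul_cancel₀ _ hM']
  have hsub : ((Finset.Ico (0 : ℤ) M).filter fun x => x + s ∉ Finset.Ico (0 : ℤ) M) ⊆
      if 0 ≤ s then Finset.Ico (M - s) (M : ℤ) else Finset.Ico 0 (-s) := by
    intro r hr
    simp only [Finset.mem_filter, Finset.mem_Ico] at hr
    split_ifs with h <;> rw [Finset.mem_Ico] <;> omega
  have hcard := Int.ofNat_le.mpr (Finset.card_le_card hsub)
  have hle : ((if 0 ≤ s then Finset.Ico (M - s) (M : ℤ) else Finset.Ico 0 (-s)).card : ℤ) ≤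
      |s| := by
    split_ifs with h
    · rw [Int.card_Ico, abs_of_nonneg h]
      omega
    · rw [Int.card_Ico, abs_of_neg (not_le.mp h)]
      omega
  exact_mod_cast hcard.trans hle

/-- The rationals `r / N` with `0 ≤ r < M`. -/
noncomputable def ratInterval (N M : ℕ) : Finset ℚ :=
  (Finset.Ico (0 : ℤ) M).image fun r : ℤ => (r : ℚ) / N

lemma ratInterval_nonempty {N M : ℕ} (hM : 0 < M) : (ratInterval N M).Nonempty :=
  (Finset.nonempty_Ico.mpr (by omega)).image _

lemma escapeRatio_ratInterval_le {N M : ℕ} (hN : N ≠ 0) (hM : 0 < M) (s : ℤ) {t : ℚ}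
    (ht : t * N = s) : escapeRatio (ratInterval N M) (fun x => x + t) ≤ |(s : ℝ)| / M := by
  have hN' : (N : ℚ) ≠ 0 := by exact_mod_cast hN
  refine le_of_eq_of_le (escapeRatio_image (f := fun x => x + s) ?_ ?_ _)
    (escapeRatio_Ico_le M hM s)
  · intro a b h
    exact_mod_cast (div_left_inj' hN').mp h
  · intro r
    rw [eq_div_of_mul_eq hN' ht]
    push_cast
    ring

section Action

variable {p : ℕ} {hp : p.Prime}

/-- The exponent of the second diagonal entry. -/
noncomputable def Gt.exp₁ (g : Gt p hp) : ℤ := g.2.1.choose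

/-- The exponent of the third diagonal entry. -/
noncomputable def Gt.exp₂ (g : Gt p hp) : ℤ := g.2.2.1.choose

/-- The integral entry in position `(4, 5)`. -/
noncomputable def Gt.shift (g : Gt p hp) : ℤ := g.2.2.2.1.choose

lemma Gt.entry_11 (g : Gt p hp) : g.val.val 1 1 = (p : ℚ) ^ Gt.exp₁ g := g.2.1.choose_spec

lemma Gt.entry_22 (g : Gt p hp) : g.val.val 2 2 = (p : ℚ) ^ Gt.exp₂ g := g.2.2.1.choose_spec

lemma Gt.entry_34 (g : Gt p hp) : g.val.val 3 4 = (Gt.shift g : ℚ) := g.2.2.2.1.choose_spec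

/-- The group `ℚ / ℤ`. -/
abbrev RatModInt : Type := ℚ ⧸ AddSubgroup.zmultiples (1 : ℚ)

/-- A set on which `G̃_p` acts. The point `((((i, j), α), β), (c, d))` represents the row vector
`(1, pⁱ α, pʲ β, c, d)` together with the diagonal exponents `i, j`, where the last two entries
are taken modulo `1`. -/
abbrev RowSpace : Type := (((ℤ × ℤ) × ℚ) × ℚ) × (RatModInt × RatModInt)

/-- Action on the diagonal exponents. -/
noncomputable def Gt.act₁ (g : Gt p hp) (x : ℤ × ℤ) : ℤ × ℤ := (x.1 + Gt.exp₁ g, x.2 + Gt.exp₂ g)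

/-- Translation of the second coordinate. -/
noncomputable def Gt.trans₂ (g : Gt p hp) (x : ℤ × ℤ) : ℚ :=
  g.val.val 0 1 / (p : ℚ) ^ (x.1 + Gt.exp₁ g)

/-- Translation of the third coordinate. -/
noncomputable def Gt.trans₃ (g : Gt p hp) (x : (ℤ × ℤ) × ℚ) : ℚ :=
  (g.val.val 0 2 + (p : ℚ) ^ x.1.1 * x.2 * g.val.val 1 2) / (p : ℚ) ^ (x.1.2 + Gt.exp₂ g)

/-- Translations of the last two coordinates. -/
noncomputable def Gt.trans₄ (g : Gt p hp) (l : Fin 5) (x : ((ℤ × ℤ) × ℚ) × ℚ) : ℚ :=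
  g.val.val 0 l + (p : ℚ) ^ x.1.1.1 * x.1.2 * g.val.val 1 l +
    (p : ℚ) ^ x.1.1.2 * x.2 * g.val.val 2 l

/-- The action of `G̃_p` on the first three coordinates of a row vector. -/
noncomputable def Gt.act₃ (g : Gt p hp) (x : ((ℤ × ℤ) × ℚ) × ℚ) : ((ℤ × ℤ) × ℚ) × ℚ :=
  ((Gt.act₁ g x.1.1, x.1.2 + Gt.trans₂ g x.1.1), x.2 + Gt.trans₃ g x.1)

/-- The fibrewise action of `G̃_p` on the last two coordinates of a row vector. -/
noncomputable def Gt.actFiber (g : Gt p hp) (x : ((ℤ × ℤ) × ℚ) × ℚ)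
    (y : RatModInt × RatModInt) : RatModInt × RatModInt :=
  (y.1 + (Gt.trans₄ g 3 x : RatModInt), y.2 + Gt.shift g • y.1 + (Gt.trans₄ g 4 x : RatModInt))

/-- The action of `G̃_p` on row vectors by right multiplication. -/
noncomputable def Gt.act (g : Gt p hp) (x : RowSpace) : RowSpace :=
  (Gt.act₃ g x.1, Gt.actFiber g x.1 x.2)

lemma Gt.entry_mul (g h : Gt p hp) (i j : Fin 5) : (g * h).val.val i j =
    g.val.val i 0 * h.val.val 0 j + g.val.val i 1 * h.val.val 1 j + g.val.val i 2 * h.val.val 2 j +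
      g.val.val i 3 * h.val.val 3 j + g.val.val i 4 * h.val.val 4 j := by
  rw [Subgroup.coe_mul, Units.val_mul, Matrix.mul_apply, Fin.sum_univ_five]

lemma Gt.act_mul (g h : Gt p hp) (x : RowSpace) : Gt.act (g * h) x = Gt.act h (Gt.act g x) := by
  have hp0 : (p : ℚ) ≠ 0 := Nat.cast_ne_zero.mpr hp.ne_zero
  have hp1 : (1 : ℚ) < p := by exact_mod_cast hp.one_lt
  obtain ⟨-, -, -, a00, a33, a44, -, -, -, -, -, -, -, -, -,
      a10, a20, a21, a30, a31, a32, a40, a41, a42, a43⟩ := g.2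
  obtain ⟨-, -, -, b00, b33, b44, -, -, -, -, -, -, -, -, -,
      b10, b20, b21, b30, b31, b32, b40, b41, b42, b43⟩ := h.2
  have e₁ : Gt.exp₁ (g * h) = Gt.exp₁ g + Gt.exp₁ h := by
    apply zpow_right_injective₀ (by linarith) hp1.ne'
    simp only [zpow_add₀ hp0, ← Gt.entry_11, Gt.entry_mul, a10, b21, b31, b41]
    ring
  have e₂ : Gt.exp₂ (g * h) = Gt.exp₂ g + Gt.exp₂ h := by
    apply zpow_right_injective₀ (by linarith) hp1.ne'
    simp only [zpow_add₀ hp0, ← Gt.entry_22, Gt.entry_mul, a20, a21, b32, b42]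
    ring
  have e₃ : Gt.shift (g * h) = Gt.shift g + Gt.shift h := by
    have : (Gt.shift (g * h) : ℚ) = Gt.shift g + Gt.shift h := by
      simp only [← Gt.entry_34, Gt.entry_mul, a30, a31, a32, a33, b44]
      ring
    exact_mod_cast this
  obtain ⟨⟨⟨⟨i, j⟩, α⟩, β⟩, c, d⟩ := x
  have c₂ : Gt.trans₂ (g * h) (i, j) = Gt.trans₂ g (i, j) + Gt.trans₂ h (Gt.act₁ g (i, j)) := by
    simp only [Gt.trans₂, Gt.act₁, Gt.entry_mul, a00, b21, b31, b41, e₁, Gt.entry_11,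
      zpow_add₀ hp0]
    field_simp
    ring
  have c₃ : Gt.trans₃ (g * h) ((i, j), α) = Gt.trans₃ g ((i, j), α) +
      Gt.trans₃ h (Gt.act₁ g (i, j), α + Gt.trans₂ g (i, j)) := by
    simp only [Gt.trans₃, Gt.trans₂, Gt.act₁, Gt.entry_mul, a00, a10, b32, b42, e₂, Gt.entry_11,
      Gt.entry_22, zpow_add₀ hp0]
    field_simp
    ring
  have c₄ : Gt.trans₄ (g * h) 3 (((i, j), α), β) = Gt.trans₄ g 3 (((i, j), α), β) +
      Gt.trans₄ h 3 (Gt.act₃ g (((i, j), α), β)) := by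
    simp only [Gt.trans₄, Gt.act₃, Gt.trans₃, Gt.trans₂, Gt.act₁, Gt.entry_mul, a00, a10, a20, a21,
      b33, b43, Gt.entry_11, Gt.entry_22, zpow_add₀ hp0]
    field_simp
    ring
  have c₅ : Gt.trans₄ (g * h) 4 (((i, j), α), β) = Gt.trans₄ g 4 (((i, j), α), β) +
      Gt.shift h • Gt.trans₄ g 3 (((i, j), α), β) + Gt.trans₄ h 4 (Gt.act₃ g (((i, j), α), β)) := by
    simp only [Gt.trans₄, Gt.act₃, Gt.trans₃, Gt.trans₂, Gt.act₁, Gt.entry_mul, a00, a10, a20, a21,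
      b44, Gt.entry_11, Gt.entry_22, zpow_add₀ hp0, zsmul_eq_mul, ← Gt.entry_34]
    field_simp
    ring
  simp only [Gt.act, Gt.actFiber, c₄, c₅, Gt.act₃, c₂, c₃, e₃, Prod.mk.injEq,
    QuotientAddGroup.mk_add, QuotientAddGroup.mk_zsmul]
  simp only [Gt.act₁, e₁, e₂, smul_add, add_smul, Prod.mk.injEq]
  refine ⟨⟨⟨⟨by ring, by ring⟩, by ring⟩, by ring⟩, by abel, by abel⟩

lemma Gt.act_one (x : RowSpace) : Gt.act (1 : Gt p hp) x = x := by
  have hp0 : (0 : ℚ) < p := Nat.cast_pos.mpr hp.pos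
  have hp1 : (1 : ℚ) < p := by exact_mod_cast hp.one_lt
  have e₁ : Gt.exp₁ (1 : Gt p hp) = 0 := by
    apply zpow_right_injective₀ hp0 hp1.ne'
    simp [← Gt.entry_11]
  have e₂ : Gt.exp₂ (1 : Gt p hp) = 0 := by
    apply zpow_right_injective₀ hp0 hp1.ne'
    simp [← Gt.entry_22]
  have e₃ : Gt.shift (1 : Gt p hp) = 0 := by
    have : (Gt.shift (1 : Gt p hp) : ℚ) = 0 := by simp [← Gt.entry_34]
    exact_mod_cast this
  simp [Gt.act, Gt.actFiber, Gt.act₃, Gt.act₁, Gt.trans₂, Gt.trans₃, Gt.trans₄, e₁, e₂, e₃]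

/-- The action of `G̃_p` on row vectors, by permutations. -/
noncomputable def Gt.actPerm (g : Gt p hp) : Equiv.Perm RowSpace where
  toFun := Gt.act g
  invFun := Gt.act g⁻¹
  left_inv x := by rw [← Gt.act_mul, mul_inv_cancel, Gt.act_one]
  right_inv x := by rw [← Gt.act_mul, inv_mul_cancel, Gt.act_one]

end Action

/-- The fractional ideal `p⁻ᵃ ℤ` of `ℚ`. -/
def fracGroup (p : ℕ) (a : ℤ) : AddSubgroup ℚ := AddSubgroup.zmultiples ((p : ℚ) ^ (-a))

section FracGroup

variable {p : ℕ}

lemma mem_fracGroup {a : ℤ} {x : ℚ} :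
    x ∈ fracGroup p a ↔ ∃ s : ℤ, (s : ℚ) * (p : ℚ) ^ (-a) = x := by
  simp [fracGroup, AddSubgroup.mem_zmultiples_iff]

lemma fracGroup_mono (hp : p.Prime) {a b : ℤ} (h : a ≤ b) : fracGroup p a ≤ fracGroup p b := by
  have hp0 : (p : ℚ) ≠ 0 := Nat.cast_ne_zero.mpr hp.ne_zero
  intro x hx
  obtain ⟨s, rfl⟩ := mem_fracGroup.mp hx
  refine mem_fracGroup.mpr ⟨s * (p : ℤ) ^ (b - a).toNat, ?_⟩
  push_cast
  rw [mul_assoc, ← zpow_natCast, ← zpow_add₀ hp0]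
  congr 2
  omega

lemma fracGroup_mul_mem (hp : p.Prime) {a b : ℤ} {x y : ℚ} (hx : x ∈ fracGroup p a)
    (hy : y ∈ fracGroup p b) : x * y ∈ fracGroup p (a + b) := by
  have hp0 : (p : ℚ) ≠ 0 := Nat.cast_ne_zero.mpr hp.ne_zero
  obtain ⟨s, rfl⟩ := mem_fracGroup.mp hx
  obtain ⟨t, rfl⟩ := mem_fracGroup.mp hy
  refine mem_fracGroup.mpr ⟨s * t, ?_⟩
  push_cast
  rw [neg_add, zpow_add₀ hp0]
  ring

lemma zpow_mem_fracGroup (a : ℤ) : (p : ℚ) ^ a ∈ fracGroup p (-a) :=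
  mem_fracGroup.mpr ⟨1, by simp⟩

lemma exists_mem_fracGroup (hp : p.Prime) {x : ℚ} (hx : x ∈ Zp p) : ∃ d : ℕ, x ∈ fracGroup p d := by
  have hp0 : (p : ℚ) ≠ 0 := Nat.cast_ne_zero.mpr hp.ne_zero
  obtain ⟨k, n, h⟩ := hx
  refine ⟨n, mem_fracGroup.mpr ⟨k, ?_⟩⟩
  rw [← h, mul_assoc, ← zpow_natCast, ← zpow_add₀ hp0]
  simp

lemma Gt.exists_entries_mem_fracGroup {hp : p.Prime} (g : Gt p hp) :
    ∃ d : ℕ, ∀ i j, g.val.val i j ∈ fracGroup p d := by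
  choose d hd using fun z : Fin 5 × Fin 5 => exists_mem_fracGroup hp (Gt_entry_mem g z.1 z.2)
  refine ⟨Finset.univ.sup d, fun i j => fracGroup_mono hp ?_ (hd (i, j))⟩
  exact_mod_cast Finset.le_sup (f := d) (Finset.mem_univ (i, j))

lemma escapeRatio_add_le (hp : p.Prime) (a b : ℕ) {t : ℚ} (ht : t ∈ fracGroup p a) :
    escapeRatio (ratInterval (p ^ a) (p ^ (a + b))) (fun x => x + t) ≤
      |(t : ℝ)| / (p : ℝ) ^ b := by
  have hp0 : (p : ℝ) ≠ 0 := Nat.cast_ne_zero.mpr hp.ne_zero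
  have hpq : (p : ℚ) ≠ 0 := Nat.cast_ne_zero.mpr hp.ne_zero
  obtain ⟨s, rfl⟩ := mem_fracGroup.mp ht
  refine (escapeRatio_ratInterval_le (pow_ne_zero _ hp.ne_zero) (pow_pos hp.pos _) s ?_).trans
    (le_of_eq ?_)
  · push_cast
    rw [zpow_neg, zpow_natCast, mul_assoc, inv_mul_cancel₀ (pow_ne_zero _ hpq), mul_one]
  · push_cast
    rw [abs_mul, zpow_neg, zpow_natCast, abs_of_nonneg (inv_nonneg.mpr (by positivity) :
      (0 : ℝ) ≤ ((p : ℝ) ^ a)⁻¹), pow_add]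
    field_simp

lemma mem_ratInterval_pow (hp : p.Prime) {a b : ℕ} {x : ℚ}
    (hx : x ∈ ratInterval (p ^ a) (p ^ (a + b))) :
    x ∈ fracGroup p a ∧ |(x : ℝ)| ≤ (p : ℝ) ^ b := by
  have hp0 : (0 : ℝ) < p := Nat.cast_pos.mpr hp.pos
  obtain ⟨r, hr, rfl⟩ := Finset.mem_image.mp hx
  obtain ⟨h0, h1⟩ := Finset.mem_Ico.mp hr
  refine ⟨mem_fracGroup.mpr ⟨r, ?_⟩, ?_⟩
  · push_cast
    rw [zpow_neg, zpow_natCast, div_eq_mul_inv]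
  · push_cast
    have h0' : (0 : ℝ) ≤ r := by exact_mod_cast h0
    have h1' : (r : ℝ) ≤ (p : ℝ) ^ (a + b) := by exact_mod_cast h1.le
    rw [abs_of_nonneg (by positivity), div_le_iff₀ (by positivity), ← pow_add, add_comm b a]
    exact h1'

lemma isOfFinAddOrder_mk_zpow (hp : p.Prime) (a : ℕ) :
    IsOfFinAddOrder (((p : ℚ) ^ (-(a : ℤ)) : ℚ) : RatModInt) := by
  have hp0 : (p : ℚ) ≠ 0 := Nat.cast_ne_zero.mpr hp.ne_zero
  refine isOfFinAddOrder_iff_nsmul_eq_zero.mpr ⟨p ^ a, pow_pos hp.pos _, ?_⟩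
  rw [← QuotientAddGroup.mk_nsmul, QuotientAddGroup.eq_zero_iff, nsmul_eq_mul, zpow_neg,
    zpow_natCast]
  push_cast
  rw [mul_inv_cancel₀ (pow_ne_zero _ hp0)]
  exact AddSubgroup.mem_zmultiples 1

/-- The image of `p⁻ᵃ ℤ` in `ℚ / ℤ`. -/
def fracGroupMod (p a : ℕ) : AddSubgroup RatModInt :=
  AddSubgroup.zmultiples (((p : ℚ) ^ (-(a : ℤ)) : ℚ) : RatModInt)

lemma mk_mem_fracGroupMod {a : ℕ} {x : ℚ} (hx : x ∈ fracGroup p a) :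
    (x : RatModInt) ∈ fracGroupMod p a := by
  obtain ⟨s, rfl⟩ := AddSubgroup.mem_zmultiples_iff.mp hx
  exact AddSubgroup.mem_zmultiples_iff.mpr ⟨s, rfl⟩

lemma fracGroupMod_finite (hp : p.Prime) (a : ℕ) :
    (fracGroupMod p a : Set RatModInt).Finite := by
  have := (isOfFinAddOrder_mk_zpow hp a)
  exact finite_zmultiples.mpr this

end FracGroup

section Folner

variable {p : ℕ}

/-- Boxes in `RowSpace` which are asymptotically invariant under `G̃_p`. -/
noncomputable def folnerBase (p R : ℕ) : Finset (((ℤ × ℤ) × ℚ) × ℚ) :=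
  ((Finset.Ico (0 : ℤ) R ×ˢ Finset.Ico (0 : ℤ) R) ×ˢ ratInterval (p ^ (2 * R)) (p ^ (2 * R + R))) ×ˢ
    ratInterval (p ^ (4 * R)) (p ^ (4 * R + 3 * R))

/-- Asymptotically invariant subsets of `RowSpace`. -/
noncomputable def folnerSet (hp : p.Prime) (R : ℕ) : Finset RowSpace :=
  folnerBase p R ×ˢ
    ((fracGroupMod_finite hp (5 * R)).toFinset ×ˢ (fracGroupMod_finite hp (5 * R)).toFinset)

variable {hp : p.Prime} {R : ℕ}

lemma folnerBase_nonempty (hp : p.Prime) (hR : 0 < R) : (folnerBase p R).Nonempty := by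
  have h : (Finset.Ico (0 : ℤ) R).Nonempty := Finset.nonempty_Ico.mpr (by omega)
  exact ((h.product h).product (ratInterval_nonempty (pow_pos hp.pos _))).product
    (ratInterval_nonempty (pow_pos hp.pos _))

lemma folnerSet_nonempty (hp : p.Prime) (hR : 0 < R) : (folnerSet hp R).Nonempty := by
  have h : (fracGroupMod_finite hp (5 * R)).toFinset.Nonempty :=
    ⟨0, (Set.Finite.mem_toFinset _).mpr (zero_mem _)⟩
  exact (folnerBase_nonempty hp hR).product (h.product h)

lemma escapeRatio_act₁_le (hR : 0 < R) (g : Gt p hp) :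
    escapeRatio (Finset.Ico (0 : ℤ) R ×ˢ Finset.Ico (0 : ℤ) R) (Gt.act₁ g) ≤
      |(Gt.exp₁ g : ℝ)| / R + |(Gt.exp₂ g : ℝ)| / R := by
  have h : (Finset.Ico (0 : ℤ) R).Nonempty := Finset.nonempty_Ico.mpr (by omega)
  exact escapeRatio_skewProduct_le (f := fun i => i + Gt.exp₁ g) (h := fun _ j => j + Gt.exp₂ g)
    h h (escapeRatio_Ico_le R hR _) (by positivity) fun _ _ _ => escapeRatio_Ico_le R hR _

lemma abs_div_zpow_le (hp : p.Prime) {k : ℤ} (hk : 0 ≤ k) (x : ℝ) : |x / (p : ℝ) ^ k| ≤ |x| := by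
  have h1 : (1 : ℝ) ≤ p := by exact_mod_cast hp.one_lt.le
  have h2 : (1 : ℝ) ≤ (p : ℝ) ^ k := one_le_zpow₀ h1 hk
  rw [abs_div, abs_of_pos (by linarith : (0 : ℝ) < (p : ℝ) ^ k)]
  exact div_le_self (abs_nonneg _) h2

lemma div_zpow_mem_fracGroup (hp : p.Prime) {a k : ℤ} {x : ℚ} (hx : x ∈ fracGroup p a) :
    x / (p : ℚ) ^ k ∈ fracGroup p (a + k) := by
  rw [div_eq_mul_inv, ← zpow_neg]
  simpa using fracGroup_mul_mem hp hx (zpow_mem_fracGroup (p := p) (-k))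

lemma zpow_mul_mem_fracGroup (hp : p.Prime) {a b c k : ℤ} (hk : 0 ≤ k) {x y : ℚ}
    (hx : x ∈ fracGroup p a) (hy : y ∈ fracGroup p b) (hc : a + b ≤ c) :
    (p : ℚ) ^ k * x * y ∈ fracGroup p c :=
  fracGroup_mono hp (by omega) (fracGroup_mul_mem hp (fracGroup_mul_mem hp (zpow_mem_fracGroup k)
    hx) hy)

lemma escapeRatio_trans₂_le (g : Gt p hp) {d : ℕ} (hd : ∀ i j, g.val.val i j ∈ fracGroup p d)
    (hdR : d ≤ R) {x : ℤ × ℤ}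
    (hx : Gt.act₁ g x ∈ Finset.Ico (0 : ℤ) R ×ˢ Finset.Ico (0 : ℤ) R) :
    escapeRatio (ratInterval (p ^ (2 * R)) (p ^ (2 * R + R))) (fun y => y + Gt.trans₂ g x) ≤
      |(g.val.val 0 1 : ℝ)| / (p : ℝ) ^ R := by
  simp only [Gt.act₁, Finset.mem_product, Finset.mem_Ico] at hx
  have ht : Gt.trans₂ g x ∈ fracGroup p (2 * R : ℕ) := by
    refine fracGroup_mono hp ?_ (div_zpow_mem_fracGroup hp (hd 0 1))
    push_cast
    omega
  refine (escapeRatio_add_le hp _ _ ht).trans ?_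
  refine div_le_div_of_nonneg_right ?_ (by positivity)
  push_cast [Gt.trans₂]
  exact abs_div_zpow_le hp hx.1.1 _

lemma escapeRatio_trans₃_le (g : Gt p hp) {d : ℕ} (hd : ∀ i j, g.val.val i j ∈ fracGroup p d)
    (hdR : d ≤ R) {x : (ℤ × ℤ) × ℚ}
    (hx : x ∈ (Finset.Ico (0 : ℤ) R ×ˢ Finset.Ico (0 : ℤ) R) ×ˢ
      ratInterval (p ^ (2 * R)) (p ^ (2 * R + R)))
    (hx' : Gt.act₁ g x.1 ∈ Finset.Ico (0 : ℤ) R ×ˢ Finset.Ico (0 : ℤ) R) :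
    escapeRatio (ratInterval (p ^ (4 * R)) (p ^ (4 * R + 3 * R))) (fun y => y + Gt.trans₃ g x) ≤
      (|(g.val.val 0 2 : ℝ)| + |(g.val.val 1 2 : ℝ)|) / (p : ℝ) ^ R := by
  have hp1 : (1 : ℝ) ≤ p := by exact_mod_cast hp.one_lt.le
  obtain ⟨⟨i, j⟩, α⟩ := x
  simp only [Gt.act₁, Finset.mem_product, Finset.mem_Ico] at hx hx'
  obtain ⟨hα, hα'⟩ := mem_ratInterval_pow hp hx.2
  have ht : Gt.trans₃ g ((i, j), α) ∈ fracGroup p (4 * R : ℕ) := by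
    refine fracGroup_mono hp ?_ (div_zpow_mem_fracGroup hp (add_mem (fracGroup_mono hp ?_ (hd 0 2))
      (zpow_mul_mem_fracGroup hp hx.1.1.1 hα (hd 1 2) (le_refl _))))
    · push_cast
      omega
    · push_cast
      omega
  refine (escapeRatio_add_le hp _ _ ht).trans ?_
  rw [div_le_div_iff₀ (by positivity) (by positivity)]
  have hi : |(p : ℝ) ^ i| ≤ (p : ℝ) ^ R := by
    rw [abs_of_nonneg (by positivity), ← zpow_natCast]
    exact zpow_le_zpow_right₀ hp1 hx.1.1.2.le
  have h1 : (1 : ℝ) ≤ (p : ℝ) ^ R * (p : ℝ) ^ R := by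
    rw [← pow_add]
    exact one_le_pow₀ hp1
  have key : |((Gt.trans₃ g ((i, j), α) : ℚ) : ℝ)| ≤
      (p : ℝ) ^ R * (p : ℝ) ^ R * (|(g.val.val 0 2 : ℝ)| + |(g.val.val 1 2 : ℝ)|) := by
    push_cast [Gt.trans₃]
    refine (abs_div_zpow_le hp hx'.2.1 _).trans ((abs_add_le _ _).trans ?_)
    rw [abs_mul, abs_mul, mul_add]
    gcongr
    exact le_mul_of_one_le_left (abs_nonneg _) h1
  calc _ ≤ _ := mul_le_mul_of_nonneg_right key (by positivity)
    _ = _ := by ring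

lemma escapeRatio_act₃_le (hR : 0 < R) (g : Gt p hp) {d : ℕ}
    (hd : ∀ i j, g.val.val i j ∈ fracGroup p d) (hdR : d ≤ R) :
    escapeRatio (folnerBase p R) (Gt.act₃ g) ≤
      |(Gt.exp₁ g : ℝ)| / R + |(Gt.exp₂ g : ℝ)| / R + |(g.val.val 0 1 : ℝ)| / (p : ℝ) ^ R +
        (|(g.val.val 0 2 : ℝ)| + |(g.val.val 1 2 : ℝ)|) / (p : ℝ) ^ R := by
  have hI : (Finset.Ico (0 : ℤ) R).Nonempty := Finset.nonempty_Ico.mpr (by omega)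
  have hA : ((Finset.Ico (0 : ℤ) R ×ˢ Finset.Ico (0 : ℤ) R) ×ˢ
      ratInterval (p ^ (2 * R)) (p ^ (2 * R + R))).Nonempty :=
    (hI.product hI).product (ratInterval_nonempty (pow_pos hp.pos _))
  have h₂ := escapeRatio_skewProduct_le (f := Gt.act₁ g) (h := fun x y => y + Gt.trans₂ g x)
    (hI.product hI) (E := ratInterval (p ^ (2 * R)) (p ^ (2 * R + R)))
    (ratInterval_nonempty (pow_pos hp.pos _)) (escapeRatio_act₁_le hR g) (by positivity)
    fun x _ hx => escapeRatio_trans₂_le g hd hdR hx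
  have h₃ := escapeRatio_skewProduct_le (h := fun x y => y + Gt.trans₃ g x) hA
    (E := ratInterval (p ^ (4 * R)) (p ^ (4 * R + 3 * R)))
    (ratInterval_nonempty (pow_pos hp.pos _)) h₂ (by positivity)
    fun x hx hx' => escapeRatio_trans₃_le g hd hdR hx (Finset.mem_product.mp hx').1
  rw [folnerBase]
  exact h₃

lemma escapeRatio_act_le (hR : 0 < R) (g : Gt p hp) {d : ℕ}
    (hd : ∀ i j, g.val.val i j ∈ fracGroup p d) (hdR : d ≤ R) :
    escapeRatio (folnerSet hp R) (Gt.act g) ≤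
      |(Gt.exp₁ g : ℝ)| / R + |(Gt.exp₂ g : ℝ)| / R + |(g.val.val 0 1 : ℝ)| / (p : ℝ) ^ R +
        (|(g.val.val 0 2 : ℝ)| + |(g.val.val 1 2 : ℝ)|) / (p : ℝ) ^ R := by
  have hC : (fracGroupMod_finite hp (5 * R)).toFinset.Nonempty :=
    ⟨0, (Set.Finite.mem_toFinset _).mpr (zero_mem _)⟩
  rw [← add_zero (_ + _ / _)]
  refine escapeRatio_skewProduct_le (folnerBase_nonempty hp hR) (hC.product hC)
    (escapeRatio_act₃_le hR g hd hdR) le_rfl ?_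
  rintro ⟨⟨⟨i, j⟩, α⟩, β⟩ hx -
  simp only [folnerBase, Finset.mem_product, Finset.mem_Ico] at hx
  have ht : ∀ l, (Gt.trans₄ g l (((i, j), α), β) : RatModInt) ∈ fracGroupMod p (5 * R) := by
    intro l
    refine mk_mem_fracGroupMod (add_mem (add_mem (fracGroup_mono hp ?_ (hd 0 l))
      (zpow_mul_mem_fracGroup hp hx.1.1.1.1 (mem_ratInterval_pow hp hx.1.2).1 (hd 1 l) ?_))
      (zpow_mul_mem_fracGroup hp hx.1.1.2.1 (mem_ratInterval_pow hp hx.2).1 (hd 2 l) ?_)) <;>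
    · push_cast
      omega
  refine (escapeRatio_eq_zero ?_).le
  rintro ⟨c, e⟩ hy
  simp only [Finset.mem_product, Set.Finite.mem_toFinset, SetLike.mem_coe, Gt.actFiber] at hy ⊢
  exact ⟨add_mem hy.1 (ht 3), add_mem (add_mem hy.2 (zsmul_mem hy.1 _)) (ht 4)⟩

lemma tendsto_escapeRatio_act (g : Gt p hp) :
    Filter.Tendsto (fun k : ℕ => escapeRatio (folnerSet hp (k + 1)) (Gt.act g)) Filter.atTop
      (nhds 0) := by
  obtain ⟨d, hd⟩ := Gt.exists_entries_mem_fracGroup g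
  have hp1 : (1 : ℝ) < p := by exact_mod_cast hp.one_lt
  have hdiv : ∀ c : ℝ, Filter.Tendsto (fun k : ℕ => c / ((k + 1 : ℕ) : ℝ)) Filter.atTop (nhds 0) :=
    fun c => (tendsto_const_div_atTop_nhds_zero_nat c).comp (Filter.tendsto_add_atTop_nat 1)
  have hpow : ∀ c : ℝ, Filter.Tendsto (fun k : ℕ => c / (p : ℝ) ^ (k + 1)) Filter.atTop (nhds 0) :=
    fun c => ((tendsto_pow_atTop_atTop_of_one_lt hp1).const_div_atTop c).comp
      (Filter.tendsto_add_atTop_nat 1)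
  refine squeeze_zero' (Filter.Eventually.of_forall fun k => escapeRatio_nonneg _ _) ?_
    (g := fun k : ℕ => |(Gt.exp₁ g : ℝ)| / ((k + 1 : ℕ) : ℝ) + |(Gt.exp₂ g : ℝ)| / ((k + 1 : ℕ) : ℝ)
      + |(g.val.val 0 1 : ℝ)| / (p : ℝ) ^ (k + 1) +
        (|(g.val.val 0 2 : ℝ)| + |(g.val.val 1 2 : ℝ)|) / (p : ℝ) ^ (k + 1)) ?_
  · filter_upwards [Filter.eventually_ge_atTop d] with k hk
    exact escapeRatio_act_le k.succ_pos g hd (hk.trans k.le_succ)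
  · simpa using (((hdiv _).add (hdiv _)).add (hpow _)).add (hpow _)

end Folner

section Transvections

variable {p : ℕ} (hp : p.Prime)

/-- The elementary matrix `1 + x E₁ₗ` of `G̃_p`, where `l` is off the diagonal. -/
def Gt.row (l : Fin 5) (hl : l ≠ 0) (x : ℚ) (hx : x ∈ Zp p) : Gt p hp :=
  ⟨⟨Matrix.transvection 0 l x, Matrix.transvection 0 l (-x),
    by rw [Matrix.transvection_mul_transvection_same _ _ hl.symm, add_neg_cancel,
      Matrix.transvection_zero],
    by rw [Matrix.transvection_mul_transvection_same _ _ hl.symm, neg_add_cancel,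
      Matrix.transvection_zero]⟩, by
    change GtPred p (Matrix.transvection 0 l x)
    refine ⟨⟨0, ?_⟩, ⟨0, ?_⟩, ⟨0, ?_⟩, ?_, ?_, ?_, ?_, ?_, ?_, ?_, ?_, ?_, ?_, ?_, ?_,
      ?_, ?_, ?_, ?_, ?_, ?_, ?_, ?_, ?_, ?_⟩ <;> fin_cases l <;>
    simp_all [Matrix.transvection, Matrix.single, zero_mem]⟩

/-- The elementary matrix `1 + Eₗ₅` of `G̃_p`, where `l` is off the diagonal. -/
def Gt.col (l : Fin 5) (hl : l ≠ 4) : Gt p hp :=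
  ⟨⟨Matrix.transvection l 4 1, Matrix.transvection l 4 (-1),
    by rw [Matrix.transvection_mul_transvection_same _ _ hl, add_neg_cancel,
      Matrix.transvection_zero],
    by rw [Matrix.transvection_mul_transvection_same _ _ hl, neg_add_cancel,
      Matrix.transvection_zero]⟩, by
    change GtPred p (Matrix.transvection l 4 1)
    have h1 : (1 : ℚ) ∈ Zp p := by exact_mod_cast Zp.intCast_mem p 1
    refine ⟨⟨0, ?_⟩, ⟨0, ?_⟩, ⟨if l = 3 then 1 else 0, ?_⟩, ?_, ?_, ?_, ?_, ?_, ?_, ?_, ?_, ?_, ?_,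
      ?_, ?_, ?_, ?_, ?_, ?_, ?_, ?_, ?_, ?_, ?_, ?_⟩ <;> fin_cases l <;>
    simp_all [Matrix.transvection, Matrix.single, zero_mem]⟩

variable {hp}

lemma Gt.row_val (l : Fin 5) (hl : l ≠ 0) (x : ℚ) (hx : x ∈ Zp p) :
    (Gt.row hp l hl x hx).val.val = 1 + Matrix.single 0 l x := rfl

lemma Gt.col_val (l : Fin 5) (hl : l ≠ 4) :
    (Gt.col hp l hl).val.val = 1 + Matrix.single l 4 1 := rfl

lemma Gt.ext_val {g h : Gt p hp} (e : g.val.val = h.val.val) : g = h := Subtype.ext (Units.ext e)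

lemma Gt.row_pow (l : Fin 5) (hl : l ≠ 0) (x : ℚ) (hx : x ∈ Zp p) (n : ℕ) (y : ℚ) (hy : y ∈ Zp p)
    (h : n * x = y) : Gt.row hp l hl x hx ^ n = Gt.row hp l hl y hy := by
  subst h
  induction n with
  | zero => exact Gt.ext_val (by simp [Gt.row_val])
  | succ n ih =>
    have hn : (n : ℚ) * x ∈ Zp p := Zp.mul_mem (by exact_mod_cast Zp.intCast_mem p n) hx
    rw [pow_succ, ih hn]
    refine Gt.ext_val (?_ : Matrix.transvection 0 l _ * Matrix.transvection 0 l _ =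
      Matrix.transvection 0 l _)
    rw [Matrix.transvection_mul_transvection_same _ _ hl.symm]
    congr 1
    push_cast
    ring

lemma Gt.row_mul_col (l : Fin 5) (h0 : l ≠ 0) (h4 : l ≠ 4) (x : ℚ) (hx : x ∈ Zp p) :
    Gt.row hp l h0 x hx * Gt.col hp l h4 =
      Gt.row hp 4 (by decide) x hx * (Gt.col hp l h4 * Gt.row hp l h0 x hx) := by
  refine Gt.ext_val ?_
  simp only [Subgroup.coe_mul, Units.val_mul, Gt.row_val, Gt.col_val, mul_add, add_mul, mul_one,
    one_mul]
  simp [h4.symm]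
  abel

lemma Gt.row_commute_row (l : Fin 5) (hl : l ≠ 0) (x y : ℚ) (hx : x ∈ Zp p) (hy : y ∈ Zp p) :
    Commute (Gt.row hp 4 (by decide) x hx) (Gt.row hp l hl y hy) := by
  refine Gt.ext_val ?_
  simp only [Subgroup.coe_mul, Units.val_mul, Gt.row_val, mul_add, add_mul, mul_one, one_mul]
  simp [hl]
  abel

lemma Gt.row_commute_col (l : Fin 5) (hl : l ≠ 4) (x : ℚ) (hx : x ∈ Zp p) :
    Commute (Gt.row hp 4 (by decide) x hx) (Gt.col hp l hl) := by
  refine Gt.ext_val ?_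
  simp only [Subgroup.coe_mul, Units.val_mul, Gt.row_val, Gt.col_val, mul_add, add_mul, mul_one,
    one_mul]
  simp [hl.symm]
  abel

lemma Gt.inv_pow_mem (p a : ℕ) (hp : p.Prime) : ((p : ℚ) ^ a)⁻¹ ∈ Zp p := by
  rw [← zpow_natCast, ← zpow_neg]
  exact Zp.zpow_mem (Nat.cast_ne_zero.mpr hp.ne_zero) _

/-- In a finite dimensional unitary representation of `G̃_p`, the central element `1 + p⁻¹ E₁₅` is
close to `1` as soon as `1 + E₁₄` is. -/
lemma Gt.hsNorm_hom_sub_one_le {n : ℕ} (σ : Gt p hp →* Matrix.unitaryGroup (Fin n) ℂ) {x : ℚ}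
    (hx : x ∈ Zp p) (hpx : p * x = 1) (h1 : (1 : ℚ) ∈ Zp p) :
    hsNorm n ((σ (Gt.row hp 4 (by decide) x hx)).val - 1) ≤
      2 * hsNorm n ((σ (Gt.row hp 3 (by decide) 1 h1)).val - 1) := by
  have hp0 : (p : ℚ) ≠ 0 := Nat.cast_ne_zero.mpr hp.ne_zero
  set W := σ (Gt.row hp 4 (by decide) x hx)
  obtain ⟨a, m, hm, hnm⟩ := Nat.exists_eq_pow_mul_and_not_dvd n.factorial_ne_zero p hp.ne_one
  have hWm : W ^ m = 1 := by
    have ha := Gt.inv_pow_mem p (a + 1) hp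
    rw [show W = σ (Gt.row hp 4 (by decide) _ ha) ^ p ^ a by
      rw [← map_pow, Gt.row_pow 4 _ _ _ (p ^ a) x hx]
      rw [eq_comm, ← mul_right_inj' hp0, hpx]
      push_cast
      field_simp
      ring, ← pow_mul, ← hnm]
    apply unitary_central_commutator_pow_factorial (A := σ (Gt.row hp 1 (by decide) _ ha))
      (B := σ (Gt.col hp 1 (by decide)))
    · exact (Gt.row_commute_row _ _ _ _ _ _).map σ
    · exact (Gt.row_commute_col _ _ _ _).map σ
    · simp only [← map_mul, Gt.row_mul_col]
  have hcop : p.Coprime (orderOf W) := (Nat.Prime.coprime_iff_not_dvd hp).mpr fun h =>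
    hm (h.trans (orderOf_dvd_of_pow_eq_one hWm))
  obtain ⟨j, hj⟩ := exists_pow_eq_self_of_coprime hcop
  have hZ : W ^ p = σ (Gt.row hp 4 (by decide) 1 h1) := by
    rw [← map_pow, Gt.row_pow 4 _ _ _ p 1 h1 hpx]
  rw [← hj, hZ]
  refine hsNorm_pow_sub_one_le (T := σ (Gt.col hp 3 (by decide)))
    ((Gt.row_commute_col _ _ _ _).symm.map σ) ?_ j
  rw [mul_assoc, inv_mul_eq_iff_eq_mul]
  simp only [← map_mul]
  congr 1
  rw [Gt.row_mul_col, ← mul_assoc, ← mul_assoc,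
    (Gt.row_commute_col 3 (by decide) (1 : ℚ) h1).eq, mul_assoc, mul_assoc,
    (Gt.row_commute_row 3 (by decide) _ _ _ _).eq]

lemma Gt.diag_row (l : Fin 5) (x : ℚ) (hx : x ∈ Zp p) (h0 : l ≠ 0) :
    Gt.exp₁ (Gt.row hp l h0 x hx) = 0 ∧ Gt.exp₂ (Gt.row hp l h0 x hx) = 0 ∧
      Gt.shift (Gt.row hp l h0 x hx) = 0 := by
  have hp0 : (0 : ℚ) < p := Nat.cast_pos.mpr hp.pos
  have hp1 : (1 : ℚ) < p := by exact_mod_cast hp.one_lt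
  refine ⟨zpow_right_injective₀ hp0 hp1.ne' ?_, zpow_right_injective₀ hp0 hp1.ne' ?_,
    Int.cast_injective (α := ℚ) ?_⟩
  · simp [← Gt.entry_11, Gt.row_val]
  · simp [← Gt.entry_22, Gt.row_val]
  · simp [← Gt.entry_34, Gt.row_val]

lemma Gt.act_row_three (h1 : (1 : ℚ) ∈ Zp p) (x : RowSpace) :
    Gt.act (Gt.row hp 3 (by decide) 1 h1) x = x := by
  obtain ⟨e₁, e₂, e₃⟩ := Gt.diag_row (hp := hp) 3 1 h1 (by decide)
  have h : ((1 : ℚ) : RatModInt) = 0 :=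
    (QuotientAddGroup.eq_zero_iff _).mpr (AddSubgroup.mem_zmultiples 1)
  simp [Gt.act, Gt.actFiber, Gt.act₃, Gt.act₁, Gt.trans₂, Gt.trans₃, Gt.trans₄, e₁, e₂, e₃,
    Gt.row_val, Matrix.single, h]

lemma Gt.act_row_four_ne {x : ℚ} (hx : x ∈ Zp p) (hpx : p * x = 1) (y : RowSpace) :
    Gt.act (Gt.row hp 4 (by decide) x hx) y ≠ y := by
  obtain ⟨e₁, e₂, e₃⟩ := Gt.diag_row (hp := hp) 4 x hx (by decide)
  intro h
  have h2 : (x : RatModInt) = 0 := by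
    have := congrArg (fun z : RowSpace => z.2.2) h
    simpa [Gt.act, Gt.actFiber, Gt.trans₄, e₃, Gt.row_val, Matrix.one_apply, Matrix.single]
      using this
  obtain ⟨k, hk⟩ := AddSubgroup.mem_zmultiples_iff.mp ((QuotientAddGroup.eq_zero_iff _).mp h2)
  rw [← hk] at hpx
  have h3 : (p : ℤ) * k = 1 := by
    have : (p : ℚ) * k = 1 := by simpa using hpx
    exact_mod_cast this
  have := Int.natAbs_dvd_natAbs.mpr (Dvd.intro k h3)
  simp only [Int.natAbs_natCast, Int.natAbs_one, Nat.dvd_one] at this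
  exact hp.ne_one this

end Transvections

/-- `G̃_p` admits asymptotic representations which are far from genuine ones. -/
lemma Gt.not_hilbertSchmidtStable (p : ℕ) (hp : p.Prime) :
    ∃ (n : ℕ → ℕ), (∀ k, 0 < n k) ∧
      ∃ π : ∀ k, Gt p hp → Matrix.unitaryGroup (Fin (n k)) ℂ,
        (∀ g h : Gt p hp, Filter.Tendsto
          (fun k => hsNorm (n k) ((π k (g * h)).val - (π k g).val * (π k h).val))
          Filter.atTop (nhds 0)) ∧
        ∀ σ : ∀ k, Gt p hp →* Matrix.unitaryGroup (Fin (n k)) ℂ, ∃ g : Gt p hp,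
          ¬ Filter.Tendsto (fun k => hsNorm (n k) ((π k g).val - (σ k g).val))
            Filter.atTop (nhds 0) := by
  have hne : ∀ k : ℕ, (folnerSet hp (k + 1)).Nonempty := fun k => folnerSet_nonempty hp k.succ_pos
  choose π hmul htriv hfar using fun k : ℕ => exists_almost_hom (Gt.actPerm (hp := hp))
    Gt.act_mul (folnerSet hp (k + 1)) (hne k)
  refine ⟨fun k => (folnerSet hp (k + 1)).card, fun k => (hne k).card_pos, π, fun g h => ?_,
    fun σ => ?_⟩
  · refine squeeze_zero (fun k => hsNorm_nonneg _ _) (fun k => hmul k g h) ?_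
    have hlim := (((tendsto_escapeRatio_act g).add (tendsto_escapeRatio_act (g * h))).const_mul
      2).sqrt
    rwa [add_zero, mul_zero, Real.sqrt_zero] at hlim
  · by_contra! hσ
    have h1 : (1 : ℚ) ∈ Zp p := by exact_mod_cast Zp.intCast_mem p 1
    have hx : (p : ℚ)⁻¹ ∈ Zp p := by simpa using Gt.inv_pow_mem p 1 hp
    have hpx : (p : ℚ) * (p : ℚ)⁻¹ = 1 := mul_inv_cancel₀ (Nat.cast_ne_zero.mpr hp.ne_zero)
    set u := Gt.row hp 3 (by decide) 1 h1
    set w := Gt.row hp 4 (by decide) _ hx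
    have hle : ∀ k, √(2 * (1 - escapeRatio (folnerSet hp (k + 1)) (Gt.act w))) ≤
        hsNorm _ ((π k w).val - (σ k w).val) + 2 * hsNorm _ ((π k u).val - (σ k u).val) := by
      intro k
      have hu : π k u = 1 := htriv k u (Gt.act_row_three h1)
      calc _ ≤ _ := hfar k w (Gt.act_row_four_ne hx hpx)
        _ ≤ _ := hsNorm_sub_le _ _ (σ k w).val _
        _ ≤ _ := by
          rw [hu, hsNorm_sub_comm _ (1 : Matrix.unitaryGroup _ ℂ).val]
          exact add_le_add_right (Gt.hsNorm_hom_sub_one_le (σ k) hx hpx h1) _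
    have hl := (((tendsto_escapeRatio_act w).const_sub 1).const_mul 2).sqrt
    have := le_of_tendsto_of_tendsto' hl ((hσ w).add ((hσ u).const_mul 2)) hle
    norm_num at this
    exact absurd this (not_le.mpr (Real.sqrt_pos.mpr two_pos))

/-- `G̃_p` is solvable and residually finite, but not Hilbert–Schmidt
stable. -/
theorem Gt_solvable_rf_not_HS_stable (p : ℕ) (hp : p.Prime) :
    IsSolvable ↥(Gt p hp) ∧
    (∀ g : ↥(Gt p hp), g ≠ 1 →
      ∃ (Q : Type) (_ : Fintype Q) (_ : Group Q) (φ : ↥(Gt p hp) →* Q), φ g ≠ 1) ∧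
    ∃ (n : ℕ → ℕ), (∀ k, 0 < n k) ∧
      ∃ π : ∀ k, ↥(Gt p hp) → Matrix.unitaryGroup (Fin (n k)) ℂ,
        (∀ g h : ↥(Gt p hp),
          Filter.Tendsto (fun k =>
            hsNorm (n k) ((π k (g * h) : Matrix (Fin (n k)) (Fin (n k)) ℂ) -
              (π k g : Matrix (Fin (n k)) (Fin (n k)) ℂ) *
                (π k h : Matrix (Fin (n k)) (Fin (n k)) ℂ))) Filter.atTop (nhds 0)) ∧
        ∀ σ : ∀ k, ↥(Gt p hp) →* Matrix.unitaryGroup (Fin (n k)) ℂ,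
          ∃ g : ↥(Gt p hp),
            ¬ Filter.Tendsto (fun k =>
                hsNorm (n k) ((π k g : Matrix (Fin (n k)) (Fin (n k)) ℂ) -
                  (σ k g : Matrix (Fin (n k)) (Fin (n k)) ℂ))) Filter.atTop (nhds 0) := by
  exact ⟨isSolvable_of_upperTriangular (Gt p hp) Gt_upper, Gt_residuallyFinite p hp,
    Gt.not_hilbertSchmidtStable p hp⟩
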